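/- Let p ≥ 2, c > 0, and assume A_{i,j} ≥ κ hᵢ for all i, j with κ > 0, and that the partition is σ-shape-regular (max hᵢ ≤ σ min hᵢ). Let u ∈ W̃_β^{2p+1,∞} be an exact solution of −(βu′)′ + γu′ + cu = f on (a,α) ∪ (α,b) with u(a) = u(b) = 0, and let u_T ∈ U_T be an IFVM solution with the same data f. Then there exist h₀ > 0 and C > 0, depending only on p, β⁻, β⁺, γ, c, κ, σ and b−a, such that for h ≤ h₀ the IFVM solution is superclose to the Gauss–Lobatto projection: sup_{x ∈ [a,b]} |u_T(x) − I_h u(x)| ≤ C h^{p+2} ‖u‖_{2p+1,∞}. -/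

import Mathlib

open Set

/-- The piecewise-constant diffusion coefficient with interface point `α`. -/
noncomputable def betaPW (βm βp α : ℝ) : ℝ → ℝ := fun t => if t < α then βm else βp

/-- Membership in the immersed trial space `U_T`: continuous on `[a,b]`, zero boundary
values, a polynomial of degree ≤ p on each non-interface element `[x_{i-1}, x_i]` (i ≠ k),
and on the interface element `[x_{k-1}, x_k]` a continuous piecewise polynomial of degree ≤ p
satisfying the derivative jump conditions at the interface `α`. -/
def MemUT (p N k : ℕ) (a b α βm βp : ℝ) (x : ℕ → ℝ) (v : ℝ → ℝ) : Prop :=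
  ContinuousOn v (Set.Icc a b) ∧ v a = 0 ∧ v b = 0 ∧
  (∀ i, 1 ≤ i → i ≤ N → i ≠ k → ∃ q : Polynomial ℝ, q.natDegree ≤ p ∧
    ∀ y ∈ Set.Icc (x (i - 1)) (x i), v y = q.eval y) ∧
  ∃ qm qp : Polynomial ℝ, qm.natDegree ≤ p ∧ qp.natDegree ≤ p ∧
    (∀ y ∈ Set.Icc (x (k - 1)) α, v y = qm.eval y) ∧
    (∀ y ∈ Set.Icc α (x k), v y = qp.eval y) ∧
    ∀ j, 1 ≤ j → j ≤ p →
      βm * ((⇑Polynomial.derivative)^[j] qm).eval α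
        = βp * ((⇑Polynomial.derivative)^[j] qp).eval α

/-- Membership in `W̃_β^{m,∞}`: continuous on `[a,b]`, zero boundary values, `C^m` on each
of `[a,α]` and `[α,b]`, and satisfying the flux jump conditions at `α` for `j = 1,…,m`. -/
def MemW (m : ℕ) (a b α βm βp : ℝ) (u : ℝ → ℝ) : Prop :=
  ContinuousOn u (Set.Icc a b) ∧ u a = 0 ∧ u b = 0 ∧
  ContDiffOn ℝ (m : ℕ∞) u (Set.Icc a α) ∧ ContDiffOn ℝ (m : ℕ∞) u (Set.Icc α b) ∧
  ∀ j, 1 ≤ j → j ≤ m →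
    βm * iteratedDerivWithin j u (Set.Icc a α) α
      = βp * iteratedDerivWithin j u (Set.Icc α b) α

/-- The broken `W^{m,∞}` norm `‖u‖_{m,∞}`: maximum of the piecewise `W^{m,∞}` norms on
`[a,α]` and `[α,b]`. -/
noncomputable def wnorm (m : ℕ) (a b α : ℝ) (u : ℝ → ℝ) : ℝ :=
  max (sSup {y : ℝ | ∃ j ≤ m, ∃ t ∈ Set.Icc a α,
        y = |iteratedDerivWithin j u (Set.Icc a α) t|})
      (sSup {y : ℝ | ∃ j ≤ m, ∃ t ∈ Set.Icc α b,
        y = |iteratedDerivWithin j u (Set.Icc α b) t|})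

section Auxiliary

open MeasureTheory intervalIntegral

lemma integral_abs_mul_le_of_sq {l r R : ℝ} {f w : ℝ → ℝ} (hlr : l ≤ r) (hw0 : ∀ t, 0 ≤ w t)
    (hw : IntervalIntegrable w volume l r)
    (h1 : IntervalIntegrable (fun t => f t * w t) volume l r)
    (h2 : IntervalIntegrable (fun t => f t ^ 2 * w t) volume l r) (hR : 0 ≤ R)
    (h : ∫ t in l..r, f t ^ 2 * w t ≤ R ^ 2 * ∫ t in l..r, w t) :
    ∫ t in l..r, |f t| * w t ≤ R * ∫ t in l..r, w t := by
  have h1' : IntervalIntegrable (fun t => |f t| * w t) volume l r := by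
    have := h1.abs
    simpa only [abs_mul, abs_of_nonneg (hw0 _)] using this
  have hI : 0 ≤ ∫ t in l..r, w t := integral_nonneg hlr fun t _ => hw0 t
  have key : ∀ m : ℝ, 0 < m → 2 * m * ∫ t in l..r, |f t| * w t ≤
      m ^ 2 * (∫ t in l..r, w t) + ∫ t in l..r, f t ^ 2 * w t := by
    intro m hm
    rw [← intervalIntegral.integral_const_mul, ← intervalIntegral.integral_const_mul,
      ← intervalIntegral.integral_add (hw.const_mul _) h2]
    refine integral_mono_on hlr (h1'.const_mul _) ((hw.const_mul _).add h2) fun t _ => ?_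
    have : 0 ≤ (m - |f t|) ^ 2 * w t := mul_nonneg (sq_nonneg _) (hw0 t)
    rw [← sq_abs (f t)]
    linarith
  rcases hR.eq_or_lt with rfl | hR
  · by_contra! hlt
    rw [zero_mul] at hlt
    set J := ∫ t in l..r, |f t| * w t
    set I := ∫ t in l..r, w t
    have := key (J / (I + 1)) (by positivity)
    have h4 : J / (I + 1) * (I + 1) = J := by field_simp
    have h5 : 0 < J / (I + 1) := by positivity
    nlinarith
  · have := key R hR
    nlinarith

section Element

variable {p : ℕ} {l r : ℝ} {w : ℝ → ℝ} {g A : ℕ → ℝ}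

lemma gauss_sum_weights
    (hq : ∀ F : Polynomial ℝ, F.natDegree ≤ 2 * p - 1 →
      ∑ j ∈ Finset.Icc 1 p, A j * F.eval (g j) = ∫ t in l..r, F.eval t * w t) :
    ∑ j ∈ Finset.Icc 1 p, A j = ∫ t in l..r, w t := by
  simpa using hq 1 (by simp)

lemma gauss_integral_sq_le (hp : 1 ≤ p)
    (hA : ∀ j ∈ Finset.Icc 1 p, 0 < A j)
    (hq : ∀ F : Polynomial ℝ, F.natDegree ≤ 2 * p - 1 →
      ∑ j ∈ Finset.Icc 1 p, A j * F.eval (g j) = ∫ t in l..r, F.eval t * w t)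
    {P : Polynomial ℝ} (hP : P.natDegree ≤ p - 1) {m : ℝ}
    (hm : ∀ j ∈ Finset.Icc 1 p, |P.eval (g j)| ≤ m) :
    ∫ t in l..r, P.eval t ^ 2 * w t ≤ m ^ 2 * ∫ t in l..r, w t := by
  have h1 := hq (P ^ 2) (Polynomial.natDegree_pow_le.trans (by omega))
  simp only [Polynomial.eval_pow] at h1
  rw [← h1, ← gauss_sum_weights hq, Finset.mul_sum]
  refine Finset.sum_le_sum fun j hj => ?_
  rw [mul_comm]
  exact mul_le_mul_of_nonneg_right (sq_le_sq' (neg_le_of_abs_le (hm j hj))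
    (le_of_abs_le (hm j hj))) (hA j hj).le

lemma gauss_integral_abs_le (hp : 1 ≤ p) (hlr : l ≤ r) (hw0 : ∀ t, 0 ≤ w t)
    (hw : IntervalIntegrable w volume l r)
    (hA : ∀ j ∈ Finset.Icc 1 p, 0 < A j)
    (hq : ∀ F : Polynomial ℝ, F.natDegree ≤ 2 * p - 1 →
      ∑ j ∈ Finset.Icc 1 p, A j * F.eval (g j) = ∫ t in l..r, F.eval t * w t)
    {P : Polynomial ℝ} (hP : P.natDegree ≤ p - 1) {m : ℝ}
    (hm : ∀ j ∈ Finset.Icc 1 p, |P.eval (g j)| ≤ m) :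
    ∫ t in l..r, |P.eval t| * w t ≤ m * ∫ t in l..r, w t := by
  have hm0 : 0 ≤ m := (abs_nonneg _).trans (hm 1 (by simp; omega))
  exact integral_abs_mul_le_of_sq hlr hw0 hw (hw.continuousOn_mul P.continuous.continuousOn)
    (hw.continuousOn_mul (P.continuous.pow 2).continuousOn) hm0 (gauss_integral_sq_le hp hA hq hP hm)

lemma projection_integral_abs_le (hlr : l ≤ r) (hw0 : ∀ t, 0 ≤ w t)
    (hw : IntervalIntegrable w volume l r) {φ : ℝ → ℝ} (hφ : ContinuousOn φ (Icc l r))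
    {Q T : Polynomial ℝ} {n : ℕ} (hQ : Q.natDegree ≤ n) (hT : T.natDegree ≤ n)
    (horth : ∀ R : Polynomial ℝ, R.natDegree ≤ n →
      ∫ t in l..r, (φ t - Q.eval t) * R.eval t * w t = 0)
    {δ : ℝ} (hδ : ∀ t ∈ Icc l r, |φ t - T.eval t| ≤ δ) :
    ∫ t in l..r, |φ t - Q.eval t| * w t ≤ 2 * δ * ∫ t in l..r, w t := by
  have hδ0 : 0 ≤ δ := (abs_nonneg _).trans (hδ l ⟨le_rfl, hlr⟩)
  have ii : ∀ {f : ℝ → ℝ}, ContinuousOn f (Icc l r) →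
      IntervalIntegrable (fun t => f t * w t) volume l r := fun hf =>
    hw.continuousOn_mul (by rwa [uIcc_of_le hlr])
  have cp : ∀ P : Polynomial ℝ, ContinuousOn (fun t => P.eval t) (Icc l r) :=
    fun P => P.continuous.continuousOn
  have cQ := cp Q
  have cT := cp T
  have hV : (Q - T).natDegree ≤ n := Polynomial.natDegree_sub_le_of_le hQ hT |>.trans (by simp)
  have h1 := horth (Q - T) hV
  simp only [Polynomial.eval_sub] at h1
  have e1 : ∫ t in l..r, (Q.eval t - T.eval t) ^ 2 * w t
      = ∫ t in l..r, ((φ t - T.eval t) * (Q.eval t - T.eval t)) * w t := by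
    rw [← sub_zero (∫ t in l..r, ((φ t - T.eval t) * (Q.eval t - T.eval t)) * w t), ← h1,
      ← intervalIntegral.integral_sub (ii (by fun_prop)) (ii (by fun_prop))]
    congr 1; ext t; ring
  have e2 : ∫ t in l..r, ((φ t - T.eval t) * (Q.eval t - T.eval t)) * w t ≤
      δ ^ 2 / 2 * (∫ t in l..r, w t) + 1 / 2 * ∫ t in l..r, (Q.eval t - T.eval t) ^ 2 * w t := by
    rw [← intervalIntegral.integral_const_mul, ← intervalIntegral.integral_const_mul,
      ← intervalIntegral.integral_add (hw.const_mul _) ((ii (by fun_prop)).const_mul _)]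
    refine integral_mono_on hlr (ii (by fun_prop))
      ((hw.const_mul _).add ((ii (by fun_prop)).const_mul _)) fun t ht => ?_
    have h3 := sq_le_sq' (neg_le_of_abs_le (hδ t ht)) (le_of_abs_le (hδ t ht))
    have h4 := sq_nonneg ((φ t - T.eval t) - (Q.eval t - T.eval t))
    have h5 : (φ t - T.eval t) * (Q.eval t - T.eval t) ≤
      δ ^ 2 / 2 + 1 / 2 * (Q.eval t - T.eval t) ^ 2 := by nlinarith
    have := mul_le_mul_of_nonneg_right h5 (hw0 t)
    linarith
  have e3 : ∫ t in l..r, |Q.eval t - T.eval t| * w t ≤ δ * ∫ t in l..r, w t :=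
    integral_abs_mul_le_of_sq hlr hw0 hw (ii (by fun_prop)) (ii (by fun_prop)) hδ0 (by linarith)
  have e4 : ∫ t in l..r, |φ t - Q.eval t| * w t ≤
      δ * (∫ t in l..r, w t) + ∫ t in l..r, |Q.eval t - T.eval t| * w t := by
    rw [← intervalIntegral.integral_const_mul,
      ← intervalIntegral.integral_add (hw.const_mul _) (ii (by fun_prop))]
    refine integral_mono_on hlr (ii (by fun_prop))
      ((hw.const_mul _).add (ii (by fun_prop))) fun t ht => ?_
    have h5 : |φ t - Q.eval t| ≤ δ + |Q.eval t - T.eval t| := by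
      have := abs_sub_le (φ t) (T.eval t) (Q.eval t)
      rw [abs_sub_comm (T.eval t)] at this
      linarith [hδ t ht]
    have := mul_le_mul_of_nonneg_right h5 (hw0 t)
    linarith
  linarith

lemma gauss_quadrature_error (hlr : l ≤ r) (hw0 : ∀ t, 0 ≤ w t)
    (hw : IntervalIntegrable w volume l r)
    (hg : ∀ j ∈ Finset.Icc 1 p, g j ∈ Icc l r)
    (hA : ∀ j ∈ Finset.Icc 1 p, 0 < A j)
    (hq : ∀ F : Polynomial ℝ, F.natDegree ≤ 2 * p - 1 →
      ∑ j ∈ Finset.Icc 1 p, A j * F.eval (g j) = ∫ t in l..r, F.eval t * w t)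
    {f : ℝ → ℝ} (hf : ContinuousOn f (Icc l r)) {T : Polynomial ℝ} (hT : T.natDegree ≤ 2 * p - 1)
    {δ : ℝ} (hδ : ∀ t ∈ Icc l r, |f t - T.eval t| ≤ δ) :
    |∑ j ∈ Finset.Icc 1 p, A j * f (g j) - ∫ t in l..r, f t * w t| ≤
      2 * δ * ∫ t in l..r, w t := by
  have ii : ∀ {f : ℝ → ℝ}, ContinuousOn f (Icc l r) →
      IntervalIntegrable (fun t => f t * w t) volume l r := fun hf =>
    hw.continuousOn_mul (by rwa [uIcc_of_le hlr])
  have cT : ContinuousOn (fun t => T.eval t) (Icc l r) := T.continuous.continuousOn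
  have e1 : ∑ j ∈ Finset.Icc 1 p, A j * f (g j) - ∫ t in l..r, f t * w t =
      ∑ j ∈ Finset.Icc 1 p, A j * (f (g j) - T.eval (g j)) -
        ∫ t in l..r, (f t - T.eval t) * w t := by
    simp only [mul_sub, sub_mul, Finset.sum_sub_distrib]
    rw [intervalIntegral.integral_sub (ii hf) (ii cT), hq T hT]
    ring
  have e2 : |∑ j ∈ Finset.Icc 1 p, A j * (f (g j) - T.eval (g j))| ≤ δ * ∫ t in l..r, w t := by
    rw [← gauss_sum_weights hq, Finset.mul_sum]
    refine (Finset.abs_sum_le_sum_abs _ _).trans (Finset.sum_le_sum fun j hj => ?_)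
    rw [abs_mul, abs_of_pos (hA j hj), mul_comm]
    exact mul_le_mul_of_nonneg_right (hδ _ (hg j hj)) (hA j hj).le
  have e3 : |∫ t in l..r, (f t - T.eval t) * w t| ≤ δ * ∫ t in l..r, w t := by
    refine (abs_integral_le_integral_abs hlr).trans ?_
    rw [← intervalIntegral.integral_const_mul]
    refine integral_mono_on hlr (ii (hf.sub cT)).abs (hw.const_mul _) fun t ht => ?_
    rw [abs_mul, abs_of_nonneg (hw0 t)]
    exact mul_le_mul_of_nonneg_right (hδ t ht) (hw0 t)
  rw [e1]
  refine (abs_sub _ _).trans ?_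
  linarith

lemma projection_nodal_error (hp : 1 ≤ p) (hlr : l < r) (hw0 : ∀ t, 0 ≤ w t)
    (hw : IntervalIntegrable w volume l r) {W κ : ℝ} (hκ : 0 < κ)
    (hW : ∫ t in l..r, w t ≤ W * (r - l))
    (hg : ∀ j ∈ Finset.Icc 1 p, g j ∈ Icc l r)
    (hA : ∀ j ∈ Finset.Icc 1 p, 0 < A j)
    (hAκ : ∀ j ∈ Finset.Icc 1 p, κ * (r - l) ≤ A j)
    (hq : ∀ F : Polynomial ℝ, F.natDegree ≤ 2 * p - 1 →
      ∑ j ∈ Finset.Icc 1 p, A j * F.eval (g j) = ∫ t in l..r, F.eval t * w t)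
    {φ : ℝ → ℝ} (hφ : ContinuousOn φ (Icc l r))
    {Q T D : Polynomial ℝ} (hQ : Q.natDegree ≤ p - 1) (hT : T.natDegree ≤ p)
    (hD : D.natDegree ≤ p - 1)
    (horth : ∀ R : Polynomial ℝ, R.natDegree ≤ p - 1 →
      ∫ t in l..r, (φ t - Q.eval t) * R.eval t * w t = 0)
    {δ : ℝ} (hδ : ∀ t ∈ Icc l r, |φ t - T.eval t| ≤ δ)
    (hDg : ∀ j ∈ Finset.Icc 1 p, D.eval (g j) = φ (g j) - Q.eval (g j)) :
    ∀ j ∈ Finset.Icc 1 p, |D.eval (g j)| ≤ 2 * √(W / κ) * δ := by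
  have hδ0 : 0 ≤ δ := (abs_nonneg _).trans (hδ l ⟨le_rfl, hlr.le⟩)
  have ii : ∀ {f : ℝ → ℝ}, ContinuousOn f (Icc l r) →
      IntervalIntegrable (fun t => f t * w t) volume l r := fun hf =>
    hw.continuousOn_mul (by rwa [uIcc_of_le hlr.le])
  have cp : ∀ P : Polynomial ℝ, ContinuousOn (fun t => P.eval t) (Icc l r) :=
    fun P => P.continuous.continuousOn
  have cQ := cp Q
  have cT := cp T
  have cD := cp D
  have q1 := hq (D * T) (Polynomial.natDegree_mul_le.trans (by omega))
  have q2 := hq (D * Q) (Polynomial.natDegree_mul_le.trans (by omega))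
  have q3 := hq (D ^ 2) (Polynomial.natDegree_pow_le.trans (by omega))
  have o := horth D hD
  simp only [Polynomial.eval_mul, Polynomial.eval_pow] at q1 q2 q3
  have hsum := gauss_sum_weights hq
  have e1 : ∑ j ∈ Finset.Icc 1 p, A j * D.eval (g j) ^ 2 =
      ∑ j ∈ Finset.Icc 1 p, A j * (D.eval (g j) * (φ (g j) - T.eval (g j))) -
        ∫ t in l..r, D.eval t * (φ t - T.eval t) * w t := by
    have a1 : ∑ j ∈ Finset.Icc 1 p, A j * D.eval (g j) ^ 2 =
      ∑ j ∈ Finset.Icc 1 p, A j * (D.eval (g j) * (φ (g j) - T.eval (g j))) +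
       (∑ j ∈ Finset.Icc 1 p, A j * (D.eval (g j) * T.eval (g j)) -
        ∑ j ∈ Finset.Icc 1 p, A j * (D.eval (g j) * Q.eval (g j))) := by
      rw [← Finset.sum_sub_distrib, ← Finset.sum_add_distrib]
      refine Finset.sum_congr rfl fun j hj => ?_
      have := hDg j hj
      rw [pow_two]
      nth_rw 2 [this]
      ring
    have a2 : ∫ t in l..r, D.eval t * (φ t - T.eval t) * w t =
      (∫ t in l..r, (φ t - Q.eval t) * D.eval t * w t) +
      ((∫ t in l..r, D.eval t * Q.eval t * w t) - ∫ t in l..r, D.eval t * T.eval t * w t) := by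
      rw [← intervalIntegral.integral_sub (ii (by fun_prop)) (ii (by fun_prop)),
        ← intervalIntegral.integral_add (ii (by fun_prop))
          ((ii (by fun_prop)).sub (ii (by fun_prop)))]
      congr 1; ext t; ring
    rw [a1, a2, q1, q2, o]; ring
  have young : ∀ x y : ℝ, |y| ≤ δ → x * y ≤ 1 / 4 * x ^ 2 + δ ^ 2 := by
    intro x y hy
    have h3 := sq_le_sq' (neg_le_of_abs_le hy) (le_of_abs_le hy)
    nlinarith [sq_nonneg (x / 2 - y)]
  have young' : ∀ x y : ℝ, |y| ≤ δ → -(1 / 4 * x ^ 2 + δ ^ 2) ≤ x * y := by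
    intro x y hy
    have := young (-x) y hy
    nlinarith
  have e2 : ∑ j ∈ Finset.Icc 1 p, A j * (D.eval (g j) * (φ (g j) - T.eval (g j))) ≤
      1 / 4 * ∑ j ∈ Finset.Icc 1 p, A j * D.eval (g j) ^ 2 + δ ^ 2 * ∫ t in l..r, w t := by
    rw [← hsum, Finset.mul_sum, Finset.mul_sum, ← Finset.sum_add_distrib]
    refine Finset.sum_le_sum fun j hj => ?_
    have := mul_le_mul_of_nonneg_left (young (D.eval (g j)) _ (hδ _ (hg j hj))) (hA j hj).le
    linarith
  have e3 : -(1 / 4 * ∑ j ∈ Finset.Icc 1 p, A j * D.eval (g j) ^ 2 + δ ^ 2 * ∫ t in l..r, w t)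
      ≤ ∫ t in l..r, D.eval t * (φ t - T.eval t) * w t := by
    rw [q3, ← intervalIntegral.integral_const_mul, ← intervalIntegral.integral_const_mul,
      ← intervalIntegral.integral_add ((ii (by fun_prop)).const_mul _) (hw.const_mul _),
      ← intervalIntegral.integral_neg]
    refine integral_mono_on hlr.le
      (((ii (by fun_prop)).const_mul _).add (hw.const_mul _)).neg (ii (by fun_prop)) fun t ht => ?_
    have := mul_le_mul_of_nonneg_right (young' (D.eval t) _ (hδ t ht)) (hw0 t)
    linarith
  intro j hj
  have e4 : A j * D.eval (g j) ^ 2 ≤ ∑ j ∈ Finset.Icc 1 p, A j * D.eval (g j) ^ 2 :=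
    Finset.single_le_sum (f := fun j => A j * D.eval (g j) ^ 2)
      (fun i hi => mul_nonneg (hA i hi).le (sq_nonneg _)) hj
  have e5 : κ * (r - l) * D.eval (g j) ^ 2 ≤ 4 * δ ^ 2 * (W * (r - l)) := by
    have h1 := mul_le_mul_of_nonneg_right (hAκ j hj) (sq_nonneg (D.eval (g j)))
    have h2 := mul_le_mul_of_nonneg_left hW (sq_nonneg δ)
    linarith
  have hlr' : 0 < r - l := sub_pos.2 hlr
  have hI : 0 ≤ ∫ t in l..r, w t := integral_nonneg hlr.le fun t _ => hw0 t
  have hW0 : 0 ≤ W := by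
    by_contra! hneg
    nlinarith [mul_pos (neg_pos.2 hneg) hlr']
  have e6 : D.eval (g j) ^ 2 ≤ (2 * √(W / κ) * δ) ^ 2 := by
    rw [mul_pow, mul_pow, Real.sq_sqrt (by positivity)]
    have : κ * D.eval (g j) ^ 2 ≤ 4 * δ ^ 2 * W := by
      refine le_of_mul_le_mul_right ?_ hlr'
      linarith
    rw [show (2 : ℝ) ^ 2 * (W / κ) * δ ^ 2 = (4 * δ ^ 2 * W) / κ by ring, le_div_iff₀ hκ]
    linarith
  exact abs_le_of_sq_le_sq e6 (by positivity)

lemma exists_interpolant (hinj : Set.InjOn g (Finset.Icc 1 p)) (y : ℕ → ℝ) :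
    ∃ P : Polynomial ℝ, P.natDegree ≤ p - 1 ∧ ∀ j ∈ Finset.Icc 1 p, P.eval (g j) = y j := by
  refine ⟨Lagrange.interpolate (Finset.Icc 1 p) g y, ?_, fun j hj =>
    Lagrange.eval_interpolate_at_node y hinj hj⟩
  have := Lagrange.degree_interpolate_le (r := y) hinj
  refine Polynomial.natDegree_le_iff_degree_le.2 (this.trans ?_)
  simp

end Element

lemma integral_mul_primitive_add {a b : ℝ} {f g : ℝ → ℝ} (hf : IntervalIntegrable f volume a b)
    (hg : IntervalIntegrable g volume a b) :
    ∫ x in a..b, (f x * (∫ t in a..x, g t) + (∫ t in a..x, f t) * g x) =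
      (∫ t in a..b, f t) * ∫ t in a..b, g t := by
  have h1 := hf.absolutelyContinuousOnInterval_intervalIntegral (c := a) (by simp)
  have h2 := hg.absolutelyContinuousOnInterval_intervalIntegral (c := a) (by simp)
  have := AbsolutelyContinuousOnInterval.integral_deriv_mul_eq_sub h1 h2
  simp only [integral_same, zero_mul, sub_zero] at this
  rw [← this]
  apply intervalIntegral.integral_congr_ae
  filter_upwards [hf.ae_hasDerivAt_integral, hg.ae_hasDerivAt_integral] with x hx1 hx2 hx
  have hx' : x ∈ uIcc a b := uIoc_subset_uIcc hx
  rw [(hx1 hx' a (by simp)).deriv, (hx2 hx' a (by simp)).deriv]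

lemma energy_estimate {a b γ c K R : ℝ} {w ζ : ℝ → ℝ} (hab : a < b) (hc : 0 ≤ c) (hR : 0 ≤ R)
    (hw0 : ∀ t, 0 ≤ w t) (hw : IntervalIntegrable w volume a b)
    (h1 : IntervalIntegrable (fun t => ζ t * w t) volume a b)
    (h2 : IntervalIntegrable (fun t => ζ t ^ 2 * w t) volume a b)
    {z : ℝ → ℝ} (hz : ∀ t, z t = ∫ s in a..t, ζ s * w s) (hzb : z b = 0)
    (hρ : ∫ t in a..b, (ζ t - (K + γ * z t + c * ∫ s in a..t, z s)) ^ 2 * w t ≤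
      R ^ 2 * ∫ t in a..b, w t) :
    (∀ t ∈ Icc a b, |z t| ≤ R * ∫ t in a..b, w t) ∧
      |K| * (∫ t in a..b, w t) ≤
        ((|γ| + c * (b - a)) * (R * ∫ t in a..b, w t) + R) * ∫ t in a..b, w t := by
  have hu : uIcc a b = Icc a b := uIcc_of_le hab.le
  have hzc : ContinuousOn z (Icc a b) := by
    have := continuousOn_primitive_interval' h1 (a := a) (by simp)
    rw [hu] at this
    exact this.congr fun t _ => hz t
  have hzi : IntervalIntegrable z volume a b := ContinuousOn.intervalIntegrable (by rwa [hu])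
  set Z : ℝ → ℝ := fun t => ∫ s in a..t, z s with hZ
  have hZc : ContinuousOn Z (Icc a b) := by
    have := continuousOn_primitive_interval' hzi (a := a) (by simp)
    rwa [hu] at this
  set L := ∫ t in a..b, w t with hL
  have hL0 : 0 ≤ L := integral_nonneg hab.le fun t _ => hw0 t
  have ii : ∀ {f : ℝ → ℝ}, ContinuousOn f (Icc a b) →
      IntervalIntegrable (fun t => f t * w t) volume a b := fun hf =>
    hw.continuousOn_mul (by rwa [hu])
  have iζ : ∀ {f : ℝ → ℝ}, ContinuousOn f (Icc a b) →
      IntervalIntegrable (fun t => f t * (ζ t * w t)) volume a b := fun hf =>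
    h1.continuousOn_mul (by rwa [hu])
  set k : ℝ → ℝ := fun t => K + γ * z t + c * Z t with hk
  have hkc : ContinuousOn k (Icc a b) := by fun_prop
  have hρ1 : IntervalIntegrable (fun t => (ζ t - k t) * w t) volume a b :=
    (h1.sub (ii hkc)).congr fun t _ => by ring
  have hρ2 : IntervalIntegrable (fun t => (ζ t - k t) ^ 2 * w t) volume a b :=
    ((h2.sub ((iζ hkc).const_mul 2)).add (ii (hkc.pow 2))).congr fun t _ => by
      simp only [Pi.pow_apply]; ring
  have hzb' : ∫ s in a..b, ζ s * w s = 0 := by rw [← hz, hzb]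
  have i1 : ∫ t in a..b, z t * (ζ t * w t) = 0 := by
    have := integral_mul_primitive_add h1 h1
    rw [hzb', zero_mul] at this
    simp only [← hz] at this
    have h3 : ∫ t in a..b, 2 * (z t * (ζ t * w t)) = 0 := by
      rw [← this]; congr 1; ext t; ring
    rw [intervalIntegral.integral_const_mul] at h3
    linarith
  have i2 : ∫ t in a..b, Z t * (ζ t * w t) ≤ 0 := by
    have := integral_mul_primitive_add hzi h1
    rw [hzb', mul_zero] at this
    simp only [← hz] at this
    rw [intervalIntegral.integral_add (hzi.mul_continuousOn (by rwa [hu])) (iζ hZc)] at this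
    have h3 : 0 ≤ ∫ t in a..b, z t * z t := integral_nonneg hab.le fun t _ => mul_self_nonneg _
    linarith
  have i3 : ∫ t in a..b, k t * (ζ t * w t) ≤ 0 := by
    have : ∫ t in a..b, k t * (ζ t * w t) = K * (∫ t in a..b, ζ t * w t) +
        γ * (∫ t in a..b, z t * (ζ t * w t)) + c * ∫ t in a..b, Z t * (ζ t * w t) := by
      rw [← intervalIntegral.integral_const_mul, ← intervalIntegral.integral_const_mul,
        ← intervalIntegral.integral_const_mul,
        ← intervalIntegral.integral_add (h1.const_mul _) ((iζ hzc).const_mul _),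
        ← intervalIntegral.integral_add ((h1.const_mul _).add ((iζ hzc).const_mul _))
          ((iζ hZc).const_mul _)]
      congr 1; ext t; simp only [hk]; ring
    rw [this, hzb', i1]
    nlinarith
  have i4 : ∫ t in a..b, ζ t ^ 2 * w t ≤ ∫ t in a..b, (ζ t - k t) ^ 2 * w t := by
    have h4 : ∫ t in a..b, ζ t ^ 2 * w t ≤
        ∫ t in a..b, ((ζ t - k t) ^ 2 * w t + 2 * (k t * (ζ t * w t))) := by
      refine integral_mono_on hab.le h2 (hρ2.add ((iζ hkc).const_mul 2)) fun t _ => ?_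
      have := mul_nonneg (sq_nonneg (k t)) (hw0 t)
      linarith
    rw [intervalIntegral.integral_add hρ2 ((iζ hkc).const_mul 2),
      intervalIntegral.integral_const_mul] at h4
    linarith
  have hζ1 : ∫ t in a..b, |ζ t| * w t ≤ R * L :=
    integral_abs_mul_le_of_sq hab.le hw0 hw h1 h2 hR (i4.trans hρ)
  have hρ1' : ∫ t in a..b, |ζ t - k t| * w t ≤ R * L :=
    integral_abs_mul_le_of_sq hab.le hw0 hw hρ1 hρ2 hR hρ
  have hzR : ∀ t ∈ Icc a b, |z t| ≤ R * L := by
    intro t ht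
    refine le_trans ?_ hζ1
    rw [hz]
    refine (abs_integral_le_integral_abs ht.1).trans ?_
    have e : (fun t => |ζ t| * w t) = fun t => |ζ t * w t| := by
      ext t; rw [abs_mul, abs_of_nonneg (hw0 t)]
    rw [e]
    exact integral_mono_interval le_rfl ht.1 ht.2 (Filter.Eventually.of_forall fun t => abs_nonneg _)
      h1.abs
  refine ⟨hzR, ?_⟩
  have hZR : ∀ t ∈ Icc a b, |Z t| ≤ (b - a) * (R * L) := by
    intro t ht
    have := norm_integral_le_of_norm_le_const (a := a) (b := t) (f := z) (C := R * L)
      fun s hs => by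
        rw [uIoc_of_le ht.1] at hs
        exact hzR s ⟨hs.1.le, hs.2.trans ht.2⟩
    rw [Real.norm_eq_abs, abs_of_nonneg (sub_nonneg.2 ht.1)] at this
    refine this.trans ?_
    rw [mul_comm]
    exact mul_le_mul_of_nonneg_right (by linarith [ht.2]) (by positivity)
  have j1 : K * L = -(∫ t in a..b, (γ * z t + c * Z t) * w t) -
      ∫ t in a..b, (ζ t - k t) * w t := by
    have : ∫ t in a..b, ζ t * w t = K * L + (∫ t in a..b, (γ * z t + c * Z t) * w t) +
        ∫ t in a..b, (ζ t - k t) * w t := by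
      rw [hL, ← intervalIntegral.integral_const_mul,
        ← intervalIntegral.integral_add (hw.const_mul _) (ii (by fun_prop)),
        ← intervalIntegral.integral_add ((hw.const_mul _).add (ii (by fun_prop))) hρ1]
      congr 1; ext t; simp only [hk]; ring
    rw [hzb'] at this
    linarith
  have j2 : |∫ t in a..b, (γ * z t + c * Z t) * w t| ≤ (|γ| + c * (b - a)) * (R * L) * L := by
    refine (abs_integral_le_integral_abs hab.le).trans ?_
    rw [hL, ← intervalIntegral.integral_const_mul]
    refine integral_mono_on hab.le (ii (by fun_prop)).abs (hw.const_mul _) fun t ht => ?_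
    rw [abs_mul, abs_of_nonneg (hw0 t)]
    refine mul_le_mul_of_nonneg_right ?_ (hw0 t)
    refine (abs_add_le _ _).trans ?_
    rw [abs_mul, abs_mul, abs_of_nonneg hc]
    have h5 := mul_le_mul_of_nonneg_left (hzR t ht) (abs_nonneg γ)
    have h6 := mul_le_mul_of_nonneg_left (hZR t ht) hc
    linarith
  have j3 : |∫ t in a..b, (ζ t - k t) * w t| ≤ R * L := by
    refine (abs_integral_le_integral_abs hab.le).trans (le_trans (le_of_eq ?_) hρ1')
    congr 1; ext t; rw [abs_mul, abs_of_nonneg (hw0 t)]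
  have j4 : |K| * L = |K * L| := by rw [abs_mul, abs_of_nonneg hL0]
  rw [j4, j1]
  refine (abs_sub _ _).trans ?_
  rw [abs_neg]
  linarith

/-- The function equal to `P i` on `(x i, x (i + 1)]` for `i < N`. -/
noncomputable def piecewisePoly (N : ℕ) (x : ℕ → ℝ) (P : ℕ → Polynomial ℝ) (t : ℝ) : ℝ :=
  (P (((Finset.range N).filter fun i => x i < t).card - 1)).eval t

/-- A mesh `x 0 < ⋯ < x N` of step at most `h`, carrying on every element a `p`-point Gauss
quadrature for the bounded weight `w`. -/
structure IsGaussMesh (p N : ℕ) (w : ℝ → ℝ) (W h κ : ℝ) (x : ℕ → ℝ) (g A : ℕ → ℕ → ℝ) :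
    Prop where
  two_le : 2 ≤ p
  pos : 1 ≤ N
  lt : ∀ i < N, x i < x (i + 1)
  step : ∀ i < N, x (i + 1) - x i ≤ h
  meas : Measurable w
  nonneg : ∀ t, 0 ≤ w t
  le : ∀ t, w t ≤ W
  mem : ∀ i < N, ∀ j ∈ Finset.Icc 1 p, g i j ∈ Icc (x i) (x (i + 1))
  inj : ∀ i < N, Set.InjOn (g i) (Finset.Icc 1 p)
  A_pos : ∀ i < N, ∀ j ∈ Finset.Icc 1 p, 0 < A i j
  kappa_pos : 0 < κ
  A_ge : ∀ i < N, ∀ j ∈ Finset.Icc 1 p, κ * (x (i + 1) - x i) ≤ A i j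
  quad : ∀ i < N, ∀ F : Polynomial ℝ, F.natDegree ≤ 2 * p - 1 →
      ∑ j ∈ Finset.Icc 1 p, A i j * F.eval (g i j) = ∫ t in (x i)..(x (i + 1)), F.eval t * w t

section Mesh

variable {N : ℕ} {x : ℕ → ℝ}

lemma mesh_mono (hx : ∀ i < N, x i < x (i + 1)) {i j : ℕ} (hij : i ≤ j) (hj : j ≤ N) :
    x i ≤ x j := by
  induction j, hij using Nat.le_induction with
  | base => rfl
  | succ n _ ih => exact (ih (by omega)).trans (hx n (by omega)).le

lemma mesh_subset (hx : ∀ i < N, x i < x (i + 1)) {i : ℕ} (hi : i < N) :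
    Icc (x i) (x (i + 1)) ⊆ Icc (x 0) (x N) :=
  Icc_subset_Icc (mesh_mono hx (Nat.zero_le _) hi.le) (mesh_mono hx (by omega) le_rfl)

lemma exists_mem_element (hN : 1 ≤ N) {t : ℝ}
    (ht : t ∈ Icc (x 0) (x N)) : ∃ i < N, t ∈ Icc (x i) (x (i + 1)) := by
  by_contra! hcon
  have : ∀ n ≤ N, x n ≤ t := by
    intro n
    induction n with
    | zero => exact fun _ => ht.1
    | succ n ih =>
      intro hn
      by_contra! hlt
      exact hcon n (by omega) ⟨ih (by omega), hlt.le⟩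
  refine hcon (N - 1) (by omega) ⟨this _ (by omega), ?_⟩
  rw [Nat.sub_add_cancel hN]
  exact ht.2

lemma piecewisePoly_eq (hx : ∀ i < N, x i < x (i + 1)) (P : ℕ → Polynomial ℝ) {i : ℕ} (hi : i < N)
    {t : ℝ} (ht : t ∈ Ioc (x i) (x (i + 1))) : piecewisePoly N x P t = (P i).eval t := by
  have : (Finset.range N).filter (fun i => x i < t) = Finset.range (i + 1) := by
    ext j
    simp only [Finset.mem_filter, Finset.mem_range]
    constructor
    · rintro ⟨h1, h2⟩
      by_contra! h3
      exact absurd h2 (not_lt.2 (ht.2.trans (mesh_mono hx h3 h1.le)))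
    · intro h1
      exact ⟨by omega, (mesh_mono hx (by omega) hi.le).trans_lt ht.1⟩
  simp [piecewisePoly, this]

lemma mesh_intervalIntegrable (hx : ∀ i < N, x i < x (i + 1)) {f : ℝ → ℝ}
    (hf : ∀ i < N, IntervalIntegrable f volume (x i) (x (i + 1))) {s t : ℝ}
    (hs : s ∈ Icc (x 0) (x N)) (ht : t ∈ Icc (x 0) (x N)) :
    IntervalIntegrable f volume s t := by
  have h0 : x 0 ≤ x N := mesh_mono hx (Nat.zero_le _) le_rfl
  refine (IntervalIntegrable.trans_iterate hf).mono_set ?_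
  rw [uIcc_of_le h0]
  exact uIcc_subset_Icc hs ht

lemma piecewisePoly_mul_intervalIntegrable (hx : ∀ i < N, x i < x (i + 1)) {w : ℝ → ℝ}
    (hw : ∀ s t, IntervalIntegrable w volume s t) (P : ℕ → Polynomial ℝ) {s t : ℝ}
    (hs : s ∈ Icc (x 0) (x N)) (ht : t ∈ Icc (x 0) (x N)) :
    IntervalIntegrable (fun t => piecewisePoly N x P t * w t) volume s t := by
  refine mesh_intervalIntegrable hx (fun i hi => ?_) hs ht
  refine ((hw (x i) (x (i + 1))).continuousOn_mul
    (P i).continuous.continuousOn).congr fun t ht => ?_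
  rw [uIoc_of_le (hx i hi).le] at ht
  rw [piecewisePoly_eq hx P hi ht]

lemma integral_piecewisePoly_mul (hx : ∀ i < N, x i < x (i + 1)) (w : ℝ → ℝ)
    (P : ℕ → Polynomial ℝ) {i : ℕ} (hi : i < N) {t : ℝ} (ht : t ∈ Icc (x i) (x (i + 1))) :
    ∫ s in (x i)..t, piecewisePoly N x P s * w s = ∫ s in (x i)..t, (P i).eval s * w s := by
  refine integral_congr_uIoo fun s hs => ?_
  rw [uIoo_of_le ht.1] at hs
  simp only [piecewisePoly_eq hx P hi ⟨hs.1, hs.2.le.trans ht.2⟩]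

lemma mesh_integral_le {f g : ℝ → ℝ}
    (hf : ∀ i < N, IntervalIntegrable f volume (x i) (x (i + 1)))
    (hg : ∀ i < N, IntervalIntegrable g volume (x i) (x (i + 1))) {C : ℝ}
    (h : ∀ i < N, ∫ t in (x i)..(x (i + 1)), f t ≤ C * ∫ t in (x i)..(x (i + 1)), g t) :
    ∫ t in (x 0)..(x N), f t ≤ C * ∫ t in (x 0)..(x N), g t := by
  rw [← sum_integral_adjacent_intervals hf, ← sum_integral_adjacent_intervals hg, Finset.mul_sum]
  exact Finset.sum_le_sum fun i hi => h i (Finset.mem_range.1 hi)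

end Mesh

lemma abs_integral_le_mul_length {f : ℝ → ℝ} {s t C : ℝ} (hst : s ≤ t)
    (hf : ∀ y ∈ Icc s t, |f y| ≤ C) : |∫ y in s..t, f y| ≤ C * (t - s) := by
  have := norm_integral_le_of_norm_le_const (a := s) (b := t) (f := f) (C := C)
    fun y hy => by
      rw [uIoc_of_le hst] at hy
      exact hf y ⟨hy.1.le, hy.2⟩
  rwa [Real.norm_eq_abs, abs_of_nonneg (sub_nonneg.2 hst)] at this

namespace IsGaussMesh

variable {p N : ℕ} {w : ℝ → ℝ} {W h κ : ℝ} {x : ℕ → ℝ} {g A : ℕ → ℕ → ℝ}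

lemma intervalIntegrable (H : IsGaussMesh p N w W h κ x g A) (s t : ℝ) :
    IntervalIntegrable w volume s t := by
  refine (intervalIntegrable_const (c := W)).mono_fun H.meas.aestronglyMeasurable ?_
  refine Filter.Eventually.of_forall fun t => ?_
  change ‖w t‖ ≤ ‖W‖
  rw [Real.norm_eq_abs, Real.norm_eq_abs, abs_of_nonneg (H.nonneg t)]
  exact (H.le t).trans (le_abs_self _)

lemma W_nonneg (H : IsGaussMesh p N w W h κ x g A) : 0 ≤ W := (H.nonneg 0).trans (H.le 0)

lemma h_pos (H : IsGaussMesh p N w W h κ x g A) : 0 < h :=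
  (sub_pos.2 (H.lt 0 H.pos)).trans_le (H.step 0 H.pos)

lemma zero_lt (H : IsGaussMesh p N w W h κ x g A) : x 0 < x N :=
  (H.lt 0 H.pos).trans_le (mesh_mono H.lt H.pos le_rfl)

lemma integral_nonneg (H : IsGaussMesh p N w W h κ x g A) {s t : ℝ} (hst : s ≤ t) :
    0 ≤ ∫ y in s..t, w y := intervalIntegral.integral_nonneg hst fun y _ => H.nonneg y

lemma integral_le (H : IsGaussMesh p N w W h κ x g A) {s t : ℝ} (hst : s ≤ t) :
    ∫ y in s..t, w y ≤ W * (t - s) :=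
  (le_abs_self _).trans (abs_integral_le_mul_length hst fun y _ => by
    rw [abs_of_nonneg (H.nonneg y)]; exact H.le y)

lemma abs_integral_mul_le_element (H : IsGaussMesh p N w W h κ x g A) {i : ℕ} {f : ℝ → ℝ}
    (hf : IntervalIntegrable (fun t => f t * w t) volume (x i) (x (i + 1)))
    {C : ℝ} (hC : ∫ t in (x i)..(x (i + 1)), |f t| * w t ≤ C) {t : ℝ}
    (ht : t ∈ Icc (x i) (x (i + 1))) : |∫ s in (x i)..t, f s * w s| ≤ C := by
  refine le_trans ?_ hC
  refine (abs_integral_le_integral_abs ht.1).trans ?_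
  have e : (fun t => |f t| * w t) = fun t => |f t * w t| := by
    ext t; rw [abs_mul, abs_of_nonneg (H.nonneg t)]
  rw [e]
  exact integral_mono_interval le_rfl ht.1 ht.2 (Filter.Eventually.of_forall fun t => abs_nonneg _)
    hf.abs

set_option maxHeartbeats 1000000 in
lemma stability (H : IsGaussMesh p N w W h κ x g A) {γ c κ' B₁ B₂ M L : ℝ} (hc : 0 ≤ c)
    {e : ℝ → ℝ} {Y s : ℕ → Polynomial ℝ}
    (hY : ∀ i < N, (Y i).natDegree ≤ p - 1) (hs : ∀ i < N, (s i).natDegree ≤ p - 1)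
    (he : ∀ t ∈ Icc (x 0) (x N), e t = (∫ y in (x 0)..t, piecewisePoly N x Y y * w y) +
      ∫ y in (x 0)..t, piecewisePoly N x s y * w y)
    (heN : e (x N) = 0)
    (hYg : ∀ i < N, ∀ j ∈ Finset.Icc 1 p,
      (Y i).eval (g i j) = κ' + γ * e (g i j) + c * ∫ y in (x 0)..(g i j), e y)
    (hsg : ∀ i < N, ∀ j ∈ Finset.Icc 1 p, |(s i).eval (g i j)| ≤ B₁)
    (hS : ∀ t ∈ Icc (x 0) (x N), |∫ y in (x 0)..t, piecewisePoly N x s y * w y| ≤ B₂)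
    (heM : ∀ t ∈ Icc (x 0) (x N), |e t| ≤ M)
    (hL : L = ∫ t in (x 0)..(x N), w t) (hLpos : 0 < L) :
    ∃ R, 0 ≤ R ∧ R = 2 * ((|γ| * ((|κ'| + (|γ| + c * (x N - x 0)) * M + B₁) * (W * h)) +
        c * (h * M)) + 2 * (|γ| + c * (x N - x 0)) * B₂) ∧
      |κ'| ≤ ((|γ| + c * (x N - x 0)) * L + 1) * R + B₂ / L ∧
      ∀ t ∈ Icc (x 0) (x N), |e t| ≤ L * R + 2 * B₂ := by
  have hp : 1 ≤ p := by have := H.two_le; omega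
  have hx := H.lt
  have h0N := H.zero_lt
  have hh := H.h_pos.le
  have hW := H.W_nonneg
  have hwi := H.intervalIntegrable
  have m0 : x 0 ∈ Icc (x 0) (x N) := ⟨le_rfl, h0N.le⟩
  have mN : x N ∈ Icc (x 0) (x N) := ⟨h0N.le, le_rfl⟩
  have hu : uIcc (x 0) (x N) = Icc (x 0) (x N) := uIcc_of_le h0N.le
  have hM0 : 0 ≤ M := (abs_nonneg _).trans (heM _ m0)
  have hB20 : 0 ≤ B₂ := (abs_nonneg _).trans (hS _ m0)
  have hB10 : 0 ≤ B₁ := (abs_nonneg _).trans (hsg 0 H.pos 1 (by simp; omega))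
  set Γ := |γ| + c * (x N - x 0) with hΓ
  have hΓ0 : 0 ≤ Γ := by have := sub_pos.2 h0N; positivity
  have pint : ∀ P : ℕ → Polynomial ℝ, ∀ {a b : ℝ}, a ∈ Icc (x 0) (x N) → b ∈ Icc (x 0) (x N) →
      IntervalIntegrable (fun t => piecewisePoly N x P t * w t) volume a b :=
    fun P _ _ => piecewisePoly_mul_intervalIntegrable hx hwi P
  have hec : ContinuousOn e (Icc (x 0) (x N)) := by
    have h1 := continuousOn_primitive_interval' (pint Y m0 mN) (a := x 0) (by simp)
    have h2 := continuousOn_primitive_interval' (pint s m0 mN) (a := x 0) (by simp)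
    rw [hu] at h1 h2
    exact (h1.add h2).congr he
  have hei : ∀ {a b : ℝ}, a ∈ Icc (x 0) (x N) → b ∈ Icc (x 0) (x N) →
      IntervalIntegrable e volume a b := fun ha hb =>
    (hec.mono (uIcc_subset_Icc ha hb)).intervalIntegrable
  have hEint : ∀ t ∈ Icc (x 0) (x N), |∫ y in (x 0)..t, e y| ≤ (x N - x 0) * M := by
    intro t ht
    refine (abs_integral_le_mul_length (C := M) ht.1
      fun y hy => heM y ⟨hy.1, hy.2.trans ht.2⟩).trans ?_
    rw [mul_comm]
    exact mul_le_mul_of_nonneg_right (by linarith [ht.2]) hM0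
  set m := |κ'| + Γ * M + B₁ with hm
  have hm0 : 0 ≤ m := by positivity
  set Ω := |γ| * (m * (W * h)) + c * (h * M) with hΩ
  have hΩ0 : 0 ≤ Ω := by positivity
  -- local oscillation of `e`
  have hosc : ∀ i < N, ∀ t ∈ Icc (x i) (x (i + 1)), |e t - e (x i)| ≤ m * (W * h) := by
    intro i hi t ht
    have hsub := mesh_subset hx hi
    have mi : x i ∈ Icc (x 0) (x N) := hsub ⟨le_rfl, (hx i hi).le⟩
    have e1 : e t - e (x i) = ∫ y in (x i)..t, (Y i + s i).eval y * w y := by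
      rw [he t (hsub ht), he (x i) mi]
      have a1 := integral_interval_sub_left (pint Y m0 (hsub ht)) (pint Y m0 mi)
      have a2 := integral_interval_sub_left (pint s m0 (hsub ht)) (pint s m0 mi)
      rw [integral_piecewisePoly_mul hx w _ hi ht] at a1 a2
      have : ∫ y in (x i)..t, (Y i + s i).eval y * w y =
          (∫ y in (x i)..t, (Y i).eval y * w y) + ∫ y in (x i)..t, (s i).eval y * w y := by
        rw [← intervalIntegral.integral_add
          ((hwi _ _).continuousOn_mul (Y i).continuous.continuousOn)
          ((hwi _ _).continuousOn_mul (s i).continuous.continuousOn)]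
        congr 1; ext y; rw [Polynomial.eval_add, add_mul]
      rw [this, ← a1, ← a2]
      ring
    rw [e1]
    refine H.abs_integral_mul_le_element
      ((hwi _ _).continuousOn_mul (Y i + s i).continuous.continuousOn) ?_ ht
    refine (gauss_integral_abs_le hp (hx i hi).le H.nonneg (hwi _ _) (H.A_pos i hi) (H.quad i hi)
      (m := m) ((Polynomial.natDegree_add_le _ _).trans (max_le (hY i hi) (hs i hi))) ?_).trans ?_
    · intro j hj
      have mg := hsub (H.mem i hi j hj)
      rw [Polynomial.eval_add, hYg i hi j hj]
      have b1 := hsg i hi j hj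
      have b2 := mul_le_mul_of_nonneg_left (heM _ mg) (abs_nonneg γ)
      have b3 := mul_le_mul_of_nonneg_left (hEint _ mg) hc
      have b4 := abs_add_le (κ' + γ * e (g i j) + c * ∫ y in (x 0)..(g i j), e y)
        ((s i).eval (g i j))
      have b5 := abs_add_three κ' (γ * e (g i j)) (c * ∫ y in (x 0)..(g i j), e y)
      rw [abs_mul γ, abs_mul c, abs_of_nonneg hc] at b5
      rw [hm, hΓ]
      linarith
    · refine mul_le_mul_of_nonneg_left ((H.integral_le (hx i hi).le).trans ?_) hm0
      exact mul_le_mul_of_nonneg_left (H.step i hi) hW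
  set ω : ℕ → ℝ → ℝ := fun i t => γ * (e t - e (x i)) + c * ∫ y in (x i)..t, e y with hω
  have hωb : ∀ i < N, ∀ t ∈ Icc (x i) (x (i + 1)), |ω i t| ≤ Ω := by
    intro i hi t ht
    have hsub := mesh_subset hx hi
    refine (abs_add_le _ _).trans ?_
    rw [abs_mul, abs_mul, abs_of_nonneg hc]
    have b1 : |∫ y in (x i)..t, e y| ≤ h * M := by
      refine (abs_integral_le_mul_length (C := M) ht.1
        fun y hy => heM y (hsub ⟨hy.1, hy.2.trans ht.2⟩)).trans ?_
      rw [mul_comm]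
      exact mul_le_mul_of_nonneg_right (by linarith [ht.2, H.step i hi]) hM0
    exact add_le_add (mul_le_mul_of_nonneg_left (hosc i hi t ht) (abs_nonneg _))
      (mul_le_mul_of_nonneg_left b1 hc)
  set O : ℕ → Polynomial ℝ := fun i =>
    Y i - Polynomial.C (κ' + γ * e (x i) + c * ∫ y in (x 0)..(x i), e y) with hO
  have hOd : ∀ i < N, (O i).natDegree ≤ p - 1 := fun i hi => by
    simpa only [hO, Polynomial.natDegree_sub_C] using hY i hi
  have hOg : ∀ i < N, ∀ j ∈ Finset.Icc 1 p, |(O i).eval (g i j)| ≤ Ω := by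
    intro i hi j hj
    have hsub := mesh_subset hx hi
    have mi : x i ∈ Icc (x 0) (x N) := hsub ⟨le_rfl, (hx i hi).le⟩
    have := integral_interval_sub_left (hei m0 (hsub (H.mem i hi j hj))) (hei m0 mi)
    have e2 : (O i).eval (g i j) = ω i (g i j) := by
      simp only [hO, hω, Polynomial.eval_sub, Polynomial.eval_C, hYg i hi j hj, ← this]
      ring
    rw [e2]
    exact hωb i hi _ (H.mem i hi j hj)
  have hOsq : ∀ i < N, ∫ t in (x i)..(x (i + 1)), (O i).eval t ^ 2 * w t ≤
      Ω ^ 2 * ∫ t in (x i)..(x (i + 1)), w t := fun i hi =>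
    gauss_integral_sq_le hp (H.A_pos i hi) (H.quad i hi) (hOd i hi) (hOg i hi)
  -- the corrected function
  set lam := (∫ y in (x 0)..(x N), piecewisePoly N x s y * w y) / L with hlam
  have hlamB : |lam| ≤ B₂ / L := by
    rw [hlam, abs_div, abs_of_pos hLpos]
    exact div_le_div_of_nonneg_right (hS _ mN) hLpos.le
  set ζ : ℝ → ℝ := fun t => piecewisePoly N x Y t + lam with hζ
  have ζ1 : ∀ {a b : ℝ}, a ∈ Icc (x 0) (x N) → b ∈ Icc (x 0) (x N) →
      IntervalIntegrable (fun t => ζ t * w t) volume a b := fun ha hb =>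
    ((pint Y ha hb).add ((hwi _ _).const_mul lam)).congr fun t _ => by
      simp only [hζ]; ring
  have ζeq : ∀ i < N, ∀ t ∈ Ioc (x i) (x (i + 1)), ζ t = (Y i).eval t + lam := fun i hi t ht => by
    simp only [hζ]; rw [piecewisePoly_eq hx Y hi ht]
  have ζ2 : IntervalIntegrable (fun t => ζ t ^ 2 * w t) volume (x 0) (x N) := by
    refine mesh_intervalIntegrable hx (fun i hi => ?_) m0 mN
    have hcont : Continuous fun t => ((Y i).eval t + lam) ^ 2 :=
      ((Y i).continuous.add continuous_const).pow 2
    refine ((hwi (x i) (x (i + 1))).continuousOn_mul hcont.continuousOn).congr fun t ht => ?_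
    rw [uIoc_of_le (hx i hi).le] at ht
    rw [ζeq i hi t ht]
  set z : ℝ → ℝ := fun t => ∫ y in (x 0)..t, ζ y * w y with hz
  have hze : ∀ t ∈ Icc (x 0) (x N), z t = e t -
      (∫ y in (x 0)..t, piecewisePoly N x s y * w y) + lam * ∫ y in (x 0)..t, w y := by
    intro t ht
    rw [he t ht, ← intervalIntegral.integral_const_mul, add_sub_cancel_right,
      ← intervalIntegral.integral_add (pint Y m0 ht) ((hwi _ _).const_mul _)]
    simp only [hz, hζ]
    congr 1; ext y; ring
  have hzN : z (x N) = 0 := by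
    rw [hze _ mN, heN, ← hL, hlam]
    field_simp; ring
  have hzeB : ∀ t ∈ Icc (x 0) (x N), |e t - z t| ≤ 2 * B₂ := by
    intro t ht
    have b1 : e t - z t = (∫ y in (x 0)..t, piecewisePoly N x s y * w y) -
      lam * ∫ y in (x 0)..t, w y := by rw [hze t ht]; ring
    rw [b1]
    refine (abs_sub _ _).trans ?_
    have b2 : |lam * ∫ y in (x 0)..t, w y| ≤ B₂ := by
      rw [abs_mul, abs_of_nonneg (H.integral_nonneg ht.1)]
      have b3 : ∫ y in (x 0)..t, w y ≤ L := by
        rw [hL]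
        exact integral_mono_interval le_rfl ht.1 ht.2
          (Filter.Eventually.of_forall fun t => H.nonneg t) (hwi _ _)
      calc |lam| * ∫ y in (x 0)..t, w y ≤ B₂ / L * L :=
            mul_le_mul hlamB b3 (H.integral_nonneg ht.1) (by positivity)
        _ = B₂ := by field_simp
    linarith [hS t ht]
  have hzc : ContinuousOn z (Icc (x 0) (x N)) := by
    have := continuousOn_primitive_interval' (ζ1 m0 mN) (a := x 0) (by simp)
    rwa [hu] at this
  have hzi : ∀ {a b : ℝ}, a ∈ Icc (x 0) (x N) → b ∈ Icc (x 0) (x N) →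
      IntervalIntegrable z volume a b := fun ha hb =>
    (hzc.mono (uIcc_subset_Icc ha hb)).intervalIntegrable
  have hZc : ContinuousOn (fun t => ∫ y in (x 0)..t, z y) (Icc (x 0) (x N)) := by
    have := continuousOn_primitive_interval' (hzi m0 mN) (a := x 0) (by simp)
    rwa [hu] at this
  set R := 2 * (Ω + 2 * Γ * B₂) with hR
  have hR0 : 0 ≤ R := by positivity
  set ρ : ℝ → ℝ := fun t => ζ t - ((κ' + lam) + γ * z t + c * ∫ y in (x 0)..t, z y) with hρ
  have hρb : ∀ i < N, ∀ t ∈ Ioc (x i) (x (i + 1)),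
      ρ t ^ 2 ≤ 2 * (O i).eval t ^ 2 + 2 * (Ω + 2 * Γ * B₂) ^ 2 := by
    intro i hi t ht
    have ht' : t ∈ Icc (x i) (x (i + 1)) := ⟨ht.1.le, ht.2⟩
    have hsub := mesh_subset hx hi
    have mi : x i ∈ Icc (x 0) (x N) := hsub ⟨le_rfl, (hx i hi).le⟩
    have a1 := integral_interval_sub_left (hei m0 (hsub ht')) (hei m0 mi)
    have a2 : ∫ y in (x 0)..t, (e y - z y) = (∫ y in (x 0)..t, e y) - ∫ y in (x 0)..t, z y :=
      intervalIntegral.integral_sub (hei m0 (hsub ht')) (hzi m0 (hsub ht'))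
    have a3 : ρ t = (O i).eval t + (-ω i t + (γ * (e t - z t) +
        c * ∫ y in (x 0)..t, (e y - z y))) := by
      simp only [hρ, hO, hω, Polynomial.eval_sub, Polynomial.eval_C, ζeq i hi t ht, ← a1, a2]
      ring
    have a4 : |∫ y in (x 0)..t, (e y - z y)| ≤ (x N - x 0) * (2 * B₂) := by
      refine (abs_integral_le_mul_length (C := 2 * B₂) (hsub ht').1
        fun y hy => hzeB y ⟨hy.1, hy.2.trans (hsub ht').2⟩).trans ?_
      rw [mul_comm]
      exact mul_le_mul_of_nonneg_right (by linarith [(hsub ht').2]) (by positivity)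
    have a5 : |-ω i t + (γ * (e t - z t) + c * ∫ y in (x 0)..t, (e y - z y))| ≤
        Ω + 2 * Γ * B₂ := by
      refine (abs_add_le _ _).trans ((add_le_add_right (abs_add_le _ _) _).trans ?_)
      rw [abs_neg, abs_mul, abs_mul, abs_of_nonneg hc]
      have b1 := hωb i hi t ht'
      have b2 := mul_le_mul_of_nonneg_left (hzeB t (hsub ht')) (abs_nonneg γ)
      have b3 := mul_le_mul_of_nonneg_left a4 hc
      rw [hΓ]
      linarith
    have a6 := sq_le_sq' (neg_le_of_abs_le a5) (le_of_abs_le a5)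
    rw [a3]
    refine add_sq_le.trans ?_
    linarith
  have hρ2 : ∀ i < N, IntervalIntegrable (fun t => ρ t ^ 2 * w t) volume (x i) (x (i + 1)) := by
    intro i hi
    have hsub := mesh_subset hx hi
    have hk : ContinuousOn (fun t => (((Y i).eval t + lam) -
        ((κ' + lam) + γ * z t + c * ∫ y in (x 0)..t, z y)) ^ 2) (Icc (x i) (x (i + 1))) := by
      have c1 := hzc.mono hsub
      have c2 := hZc.mono hsub
      have c3 : ContinuousOn (fun t => (Y i).eval t) (Icc (x i) (x (i + 1))) :=
        (Y i).continuous.continuousOn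
      fun_prop
    refine ((hwi (x i) (x (i + 1))).continuousOn_mul
      (by rwa [uIcc_of_le (hx i hi).le])).congr fun t ht => ?_
    rw [uIoc_of_le (hx i hi).le] at ht
    simp only [hρ, ζeq i hi t ht]
  have hρR : ∫ t in (x 0)..(x N), ρ t ^ 2 * w t ≤ R ^ 2 * ∫ t in (x 0)..(x N), w t := by
    refine mesh_integral_le hρ2 (fun i hi => hwi _ _) fun i hi => ?_
    have hOi : IntervalIntegrable (fun t => (O i).eval t ^ 2 * w t) volume (x i) (x (i + 1)) :=
      (hwi _ _).continuousOn_mul ((O i).continuous.pow 2).continuousOn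
    have b1 : ∫ t in (x i)..(x (i + 1)), ρ t ^ 2 * w t ≤
        ∫ t in (x i)..(x (i + 1)), (2 * ((O i).eval t ^ 2 * w t) +
          2 * (Ω + 2 * Γ * B₂) ^ 2 * w t) := by
      refine integral_mono_on_of_le_Ioo (hx i hi).le (hρ2 i hi)
        ((hOi.const_mul 2).add ((hwi _ _).const_mul _)) fun t ht => ?_
      have := mul_le_mul_of_nonneg_right (hρb i hi t ⟨ht.1, ht.2.le⟩) (H.nonneg t)
      linarith
    rw [intervalIntegral.integral_add (hOi.const_mul 2) ((hwi _ _).const_mul _),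
      intervalIntegral.integral_const_mul, intervalIntegral.integral_const_mul] at b1
    have b2 := hOsq i hi
    have b3 := H.integral_nonneg (hx i hi).le
    have b4 : Ω ^ 2 ≤ (Ω + 2 * Γ * B₂) ^ 2 :=
      pow_le_pow_left₀ hΩ0 (le_add_of_nonneg_right (by positivity)) 2
    have b5 := mul_le_mul_of_nonneg_right b4 b3
    have b6 : R ^ 2 = 4 * (Ω + 2 * Γ * B₂) ^ 2 := by rw [hR]; ring
    rw [b6]
    linarith
  obtain ⟨r1, r2⟩ := energy_estimate (γ := γ) (K := κ' + lam) h0N hc hR0 H.nonneg (hwi _ _)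
    (ζ1 m0 mN) ζ2 (z := z) (fun t => rfl) hzN hρR
  rw [← hL] at r1 r2
  refine ⟨R, hR0, rfl, ?_, ?_⟩
  · have r3 := le_of_mul_le_mul_right r2 hLpos
    have r4 : |κ'| ≤ |κ' + lam| + |lam| := by
      have := abs_sub (κ' + lam) lam
      rwa [add_sub_cancel_right] at this
    linarith
  · intro t ht
    have := abs_add_le (e t - z t) (z t)
    rw [sub_add_cancel] at this
    linarith [hzeB t ht, r1 t ht]

end IsGaussMesh

lemma exists_polynomial_antiderivative (R : Polynomial ℝ) :
    ∃ q : Polynomial ℝ, Polynomial.derivative q = R ∧ q.natDegree ≤ R.natDegree + 1 := by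
  refine ⟨∑ n ∈ Finset.range (R.natDegree + 1),
    Polynomial.monomial (n + 1) (R.coeff n / (n + 1)), ?_, ?_⟩
  · rw [Polynomial.derivative_sum]
    conv_rhs => rw [R.as_sum_range]
    refine Finset.sum_congr rfl fun n _ => ?_
    rw [Polynomial.derivative_monomial]
    have : (n : ℝ) + 1 ≠ 0 := by positivity
    simp [this]
  · refine Polynomial.natDegree_sum_le_of_forall_le _ _ fun n hn => ?_
    refine (Polynomial.natDegree_monomial_le _).trans ?_
    have := Finset.mem_range.1 hn
    omega

lemma integral_derivative_eval (q : Polynomial ℝ) (s t : ℝ) :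
    ∫ y in s..t, (Polynomial.derivative q).eval y = q.eval t - q.eval s :=
  integral_eq_sub_of_hasDerivAt (fun y _ => q.hasDerivAt y)
    (Polynomial.derivative q).continuous.continuousOn.intervalIntegrable

namespace IsGaussMesh

variable {p N : ℕ} {w : ℝ → ℝ} {W h κ : ℝ} {x : ℕ → ℝ} {g A : ℕ → ℕ → ℝ}

section Projection

variable {φ : ℝ → ℝ} {Q : ℕ → Polynomial ℝ} {M : ℝ}

/-- The primitive of the projection error. -/
noncomputable def errorPrimitive (N : ℕ) (x : ℕ → ℝ) (w φ : ℝ → ℝ) (Q : ℕ → Polynomial ℝ)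
    (t : ℝ) : ℝ := ∫ y in (x 0)..t, (φ y - piecewisePoly N x Q y) * w y

lemma error_intervalIntegrable (H : IsGaussMesh p N w W h κ x g A)
    (hφ : ContinuousOn φ (Icc (x 0) (x N))) {s t : ℝ}
    (hs : s ∈ Icc (x 0) (x N)) (ht : t ∈ Icc (x 0) (x N)) :
    IntervalIntegrable (fun y => (φ y - piecewisePoly N x Q y) * w y) volume s t := by
  refine (((H.intervalIntegrable s t).continuousOn_mul (hφ.mono (uIcc_subset_Icc hs ht))).sub
    (piecewisePoly_mul_intervalIntegrable H.lt H.intervalIntegrable Q hs ht)).congr fun y _ => ?_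
  ring

lemma integral_error_element (H : IsGaussMesh p N w W h κ x g A) {i : ℕ} (hi : i < N) {t : ℝ}
    (ht : t ∈ Icc (x i) (x (i + 1))) :
    ∫ s in (x i)..t, (φ s - piecewisePoly N x Q s) * w s =
      ∫ s in (x i)..t, (φ s - (Q i).eval s) * w s := by
  refine integral_congr_uIoo fun s hs => ?_
  rw [uIoo_of_le ht.1] at hs
  simp only [piecewisePoly_eq H.lt Q hi ⟨hs.1, hs.2.le.trans ht.2⟩]

lemma errorPrimitive_node (H : IsGaussMesh p N w W h κ x g A)
    (hφ : ContinuousOn φ (Icc (x 0) (x N)))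
    (horth : ∀ i < N, ∀ R : Polynomial ℝ, R.natDegree ≤ p - 1 →
      ∫ t in (x i)..(x (i + 1)), (φ t - (Q i).eval t) * R.eval t * w t = 0) :
    ∀ i ≤ N, errorPrimitive N x w φ Q (x i) = 0 := by
  intro i
  induction i with
  | zero => intro _; simp [errorPrimitive]
  | succ n ih =>
    intro hn
    have hsub := mesh_subset H.lt (i := n) (by omega)
    have h1 : x n ∈ Icc (x 0) (x N) := hsub ⟨le_rfl, (H.lt n (by omega)).le⟩
    have h2 : x (n + 1) ∈ Icc (x 0) (x N) := hsub ⟨(H.lt n (by omega)).le, le_rfl⟩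
    have h0 : x 0 ∈ Icc (x 0) (x N) := ⟨le_rfl, H.zero_lt.le⟩
    have h3 := horth n (by omega) 1 (by simp)
    simp only [Polynomial.eval_one, mul_one] at h3
    unfold errorPrimitive at ih ⊢
    rw [← integral_add_adjacent_intervals (H.error_intervalIntegrable hφ h0 h1)
      (H.error_intervalIntegrable hφ h1 h2), ih (by omega),
      H.integral_error_element (by omega) ⟨(H.lt n (by omega)).le, le_rfl⟩, h3, add_zero]

lemma errorPrimitive_eq (H : IsGaussMesh p N w W h κ x g A)
    (hφ : ContinuousOn φ (Icc (x 0) (x N)))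
    (horth : ∀ i < N, ∀ R : Polynomial ℝ, R.natDegree ≤ p - 1 →
      ∫ t in (x i)..(x (i + 1)), (φ t - (Q i).eval t) * R.eval t * w t = 0)
    {i : ℕ} (hi : i < N) {t : ℝ} (ht : t ∈ Icc (x i) (x (i + 1))) :
    errorPrimitive N x w φ Q t = ∫ s in (x i)..t, (φ s - (Q i).eval s) * w s := by
  have hsub := mesh_subset H.lt hi
  have h1 : x i ∈ Icc (x 0) (x N) := hsub ⟨le_rfl, (H.lt i hi).le⟩
  have h0 : x 0 ∈ Icc (x 0) (x N) := ⟨le_rfl, H.zero_lt.le⟩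
  have h3 := H.errorPrimitive_node hφ horth i hi.le
  unfold errorPrimitive at h3 ⊢
  rw [← integral_add_adjacent_intervals (H.error_intervalIntegrable hφ h0 h1)
    (H.error_intervalIntegrable hφ h1 (hsub ht)), h3, zero_add, H.integral_error_element hi ht]

lemma errorPrimitive_continuousOn (H : IsGaussMesh p N w W h κ x g A)
    (hφ : ContinuousOn φ (Icc (x 0) (x N))) :
    ContinuousOn (errorPrimitive N x w φ Q) (Icc (x 0) (x N)) := by
  have := continuousOn_primitive_interval' (H.error_intervalIntegrable (Q := Q) hφ
    ⟨le_rfl, H.zero_lt.le⟩ ⟨H.zero_lt.le, le_rfl⟩) (a := x 0) (by simp)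
  rwa [uIcc_of_le H.zero_lt.le] at this

lemma abs_errorPrimitive_le (H : IsGaussMesh p N w W h κ x g A)
    (hφ : ContinuousOn φ (Icc (x 0) (x N))) (hQ : ∀ i < N, (Q i).natDegree ≤ p - 1)
    (horth : ∀ i < N, ∀ R : Polynomial ℝ, R.natDegree ≤ p - 1 →
      ∫ t in (x i)..(x (i + 1)), (φ t - (Q i).eval t) * R.eval t * w t = 0)
    (hM : 0 ≤ M)
    (hT : ∀ m ≤ p + 1, ∀ i < N, ∃ T : Polynomial ℝ, T.natDegree ≤ m ∧
      ∀ t ∈ Icc (x i) (x (i + 1)), |φ t - T.eval t| ≤ M * h ^ (m + 1))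
    {t : ℝ} (ht : t ∈ Icc (x 0) (x N)) :
    |errorPrimitive N x w φ Q t| ≤ 2 * W * (M * h ^ (p + 1)) := by
  obtain ⟨i, hi, hti⟩ := exists_mem_element H.pos ht
  have hp := H.two_le
  have hφi := hφ.mono (mesh_subset H.lt hi)
  obtain ⟨T, hTd, hTe⟩ := hT (p - 1) (by omega) i hi
  rw [Nat.sub_add_cancel (by omega)] at hTe
  rw [H.errorPrimitive_eq hφ horth hi hti]
  have hc : ContinuousOn (fun s => φ s - (Q i).eval s) (Icc (x i) (x (i + 1))) :=
    hφi.sub (Q i).continuous.continuousOn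
  refine H.abs_integral_mul_le_element ((H.intervalIntegrable _ _).continuousOn_mul
    (by rwa [uIcc_of_le (H.lt i hi).le])) ?_ hti
  refine (projection_integral_abs_le (H.lt i hi).le H.nonneg (H.intervalIntegrable _ _) hφi
    (hQ i hi) hTd (horth i hi) hTe).trans ?_
  have h1 : ∫ t in (x i)..(x (i + 1)), w t ≤ W * h :=
    (H.integral_le (H.lt i hi).le).trans (mul_le_mul_of_nonneg_left (H.step i hi) H.W_nonneg)
  have h2 : 0 ≤ 2 * (M * h ^ p) := by have := H.h_pos; positivity
  refine (mul_le_mul_of_nonneg_left h1 h2).trans (le_of_eq ?_)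
  ring

lemma integral_errorPrimitive_element (H : IsGaussMesh p N w W h κ x g A)
    (hφ : ContinuousOn φ (Icc (x 0) (x N)))
    (horth : ∀ i < N, ∀ R : Polynomial ℝ, R.natDegree ≤ p - 1 →
      ∫ t in (x i)..(x (i + 1)), (φ t - (Q i).eval t) * R.eval t * w t = 0)
    {i : ℕ} (hi : i < N) :
    ∫ t in (x i)..(x (i + 1)), errorPrimitive N x w φ Q t = 0 := by
  have hp := H.two_le
  have hlt := (H.lt i hi).le
  have hc : ContinuousOn (fun s => φ s - (Q i).eval s) (uIcc (x i) (x (i + 1))) := by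
    rw [uIcc_of_le hlt]
    exact (hφ.mono (mesh_subset H.lt hi)).sub (Q i).continuous.continuousOn
  have h1 := (H.intervalIntegrable (x i) (x (i + 1))).continuousOn_mul hc
  have h2 := integral_mul_primitive_add (intervalIntegrable_const (c := (1 : ℝ))) h1
  have h3 := horth i hi 1 (by simp)
  have h4 := horth i hi (Polynomial.X - Polynomial.C (x i)) (by
    rw [Polynomial.natDegree_X_sub_C]; omega)
  simp only [Polynomial.eval_one, mul_one] at h3
  simp only [Polynomial.eval_sub, Polynomial.eval_X, Polynomial.eval_C] at h4
  rw [h3, mul_zero] at h2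
  have h5 := (continuousOn_primitive_interval' h1 (a := x i) (by simp)).intervalIntegrable
    (μ := volume)
  have h6 : IntervalIntegrable (fun t => (φ t - (Q i).eval t) * (t - x i) * w t) volume
      (x i) (x (i + 1)) :=
    (H.intervalIntegrable _ _).continuousOn_mul (hc.mul (by fun_prop))
  have h7 : ∫ t in (x i)..(x (i + 1)), ((∫ s in (x i)..t, (φ s - (Q i).eval s) * w s) +
      (φ t - (Q i).eval t) * (t - x i) * w t) = 0 := by
    rw [← h2]
    refine integral_congr fun t _ => ?_
    simp only [intervalIntegral.integral_const, smul_eq_mul]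
    ring
  rw [intervalIntegral.integral_add h5 h6, h4, add_zero] at h7
  rw [← h7]
  refine integral_congr fun t ht => ?_
  rw [uIcc_of_le hlt] at ht
  exact H.errorPrimitive_eq hφ horth hi ht

lemma abs_integral_errorPrimitive_le (H : IsGaussMesh p N w W h κ x g A)
    (hφ : ContinuousOn φ (Icc (x 0) (x N))) (hQ : ∀ i < N, (Q i).natDegree ≤ p - 1)
    (horth : ∀ i < N, ∀ R : Polynomial ℝ, R.natDegree ≤ p - 1 →
      ∫ t in (x i)..(x (i + 1)), (φ t - (Q i).eval t) * R.eval t * w t = 0)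
    (hM : 0 ≤ M)
    (hT : ∀ m ≤ p + 1, ∀ i < N, ∃ T : Polynomial ℝ, T.natDegree ≤ m ∧
      ∀ t ∈ Icc (x i) (x (i + 1)), |φ t - T.eval t| ≤ M * h ^ (m + 1))
    {t : ℝ} (ht : t ∈ Icc (x 0) (x N)) :
    |∫ s in (x 0)..t, errorPrimitive N x w φ Q s| ≤ 2 * W * (M * h ^ (p + 2)) := by
  have hint : ∀ {a b : ℝ}, a ∈ Icc (x 0) (x N) → b ∈ Icc (x 0) (x N) →
      IntervalIntegrable (errorPrimitive N x w φ Q) volume a b := fun ha hb =>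
    ((H.errorPrimitive_continuousOn hφ).mono (uIcc_subset_Icc ha hb)).intervalIntegrable
  have h0 : x 0 ∈ Icc (x 0) (x N) := ⟨le_rfl, H.zero_lt.le⟩
  have hnode : ∀ i ≤ N, ∫ s in (x 0)..(x i), errorPrimitive N x w φ Q s = 0 := by
    intro i
    induction i with
    | zero => intro _; simp
    | succ n ih =>
      intro hn
      have hsub := mesh_subset H.lt (i := n) (by omega)
      have h1 : x n ∈ Icc (x 0) (x N) := hsub ⟨le_rfl, (H.lt n (by omega)).le⟩
      have h2 : x (n + 1) ∈ Icc (x 0) (x N) := hsub ⟨(H.lt n (by omega)).le, le_rfl⟩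
      rw [← integral_add_adjacent_intervals (hint h0 h1) (hint h1 h2), ih (by omega),
        H.integral_errorPrimitive_element hφ horth (by omega), add_zero]
  obtain ⟨i, hi, hti⟩ := exists_mem_element H.pos ht
  have hsub := mesh_subset H.lt hi
  have h1 : x i ∈ Icc (x 0) (x N) := hsub ⟨le_rfl, (H.lt i hi).le⟩
  rw [← integral_add_adjacent_intervals (hint h0 h1) (hint h1 ht), hnode i hi.le, zero_add]
  refine (abs_integral_le_mul_length hti.1 fun y hy => H.abs_errorPrimitive_le hφ hQ horth hM hT
    (hsub ⟨hy.1, hy.2.trans hti.2⟩)).trans ?_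
  have h2 : t - x i ≤ h := by linarith [hti.2, H.step i hi]
  have h3 : 0 ≤ 2 * W * (M * h ^ (p + 1)) := by have := H.h_pos; have := H.W_nonneg; positivity
  refine (mul_le_mul_of_nonneg_left h2 h3).trans (le_of_eq ?_)
  ring

lemma abs_nodal_error_le (H : IsGaussMesh p N w W h κ x g A)
    (hφ : ContinuousOn φ (Icc (x 0) (x N))) (hQ : ∀ i < N, (Q i).natDegree ≤ p - 1)
    (horth : ∀ i < N, ∀ R : Polynomial ℝ, R.natDegree ≤ p - 1 →
      ∫ t in (x i)..(x (i + 1)), (φ t - (Q i).eval t) * R.eval t * w t = 0)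
    (hT : ∀ m ≤ p + 1, ∀ i < N, ∃ T : Polynomial ℝ, T.natDegree ≤ m ∧
      ∀ t ∈ Icc (x i) (x (i + 1)), |φ t - T.eval t| ≤ M * h ^ (m + 1))
    {i : ℕ} (hi : i < N) {j : ℕ} (hj : j ∈ Finset.Icc 1 p) :
    |φ (g i j) - (Q i).eval (g i j)| ≤ 2 * √(W / κ) * (M * h ^ (p + 1)) := by
  have hp := H.two_le
  obtain ⟨D, hD, hDg⟩ := exists_interpolant (H.inj i hi)
    fun j => φ (g i j) - (Q i).eval (g i j)
  obtain ⟨T, hTd, hTe⟩ := hT p (by omega) i hi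
  rw [← hDg j hj]
  exact projection_nodal_error (by omega) (H.lt i hi) H.nonneg (H.intervalIntegrable _ _)
    H.kappa_pos (H.integral_le (H.lt i hi).le) (H.mem i hi) (H.A_pos i hi) (H.A_ge i hi)
    (H.quad i hi) (hφ.mono (mesh_subset H.lt hi)) (hQ i hi) hTd hD (horth i hi) hTe hDg j hj

lemma abs_quadrature_nodal_error_le (H : IsGaussMesh p N w W h κ x g A)
    (hφ : ContinuousOn φ (Icc (x 0) (x N))) (hQ : ∀ i < N, (Q i).natDegree ≤ p - 1)
    (horth : ∀ i < N, ∀ R : Polynomial ℝ, R.natDegree ≤ p - 1 →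
      ∫ t in (x i)..(x (i + 1)), (φ t - (Q i).eval t) * R.eval t * w t = 0)
    (hT : ∀ m ≤ p + 1, ∀ i < N, ∃ T : Polynomial ℝ, T.natDegree ≤ m ∧
      ∀ t ∈ Icc (x i) (x (i + 1)), |φ t - T.eval t| ≤ M * h ^ (m + 1))
    {i : ℕ} (hi : i < N) :
    |∑ j ∈ Finset.Icc 1 p, A i j * (φ (g i j) - (Q i).eval (g i j))| ≤
      2 * (M * h ^ (p + 2)) * ∫ t in (x i)..(x (i + 1)), w t := by
  have hp := H.two_le
  have hφi := hφ.mono (mesh_subset H.lt hi)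
  obtain ⟨T, hTd, hTe⟩ := hT (p + 1) le_rfl i hi
  have h1 := gauss_quadrature_error (H.lt i hi).le H.nonneg (H.intervalIntegrable _ _)
    (H.mem i hi) (H.A_pos i hi) (H.quad i hi) hφi (T := T) (by omega) hTe
  have h2 := H.quad i hi (Q i) ((hQ i hi).trans (by omega))
  have h3 := horth i hi 1 (by simp)
  simp only [Polynomial.eval_one, mul_one, sub_mul] at h3
  rw [intervalIntegral.integral_sub
    ((H.intervalIntegrable _ _).continuousOn_mul (by rwa [uIcc_of_le (H.lt i hi).le]))
    ((H.intervalIntegrable _ _).continuousOn_mul (Q i).continuous.continuousOn)] at h3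
  have h4 : ∑ j ∈ Finset.Icc 1 p, A i j * (φ (g i j) - (Q i).eval (g i j)) =
      ∑ j ∈ Finset.Icc 1 p, A i j * φ (g i j) - ∫ t in (x i)..(x (i + 1)), φ t * w t := by
    simp only [mul_sub, Finset.sum_sub_distrib]
    rw [h2]
    linarith
  rw [h4]
  exact h1

lemma abs_quadrature_errorPrimitive_le (H : IsGaussMesh p N w W h κ x g A)
    (hφ : ContinuousOn φ (Icc (x 0) (x N))) (hQ : ∀ i < N, (Q i).natDegree ≤ p - 1)
    (horth : ∀ i < N, ∀ R : Polynomial ℝ, R.natDegree ≤ p - 1 →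
      ∫ t in (x i)..(x (i + 1)), (φ t - (Q i).eval t) * R.eval t * w t = 0)
    (hM : 0 ≤ M)
    (hT : ∀ m ≤ p + 1, ∀ i < N, ∃ T : Polynomial ℝ, T.natDegree ≤ m ∧
      ∀ t ∈ Icc (x i) (x (i + 1)), |φ t - T.eval t| ≤ M * h ^ (m + 1))
    {i : ℕ} (hi : i < N) {v : ℝ} (hv : ∀ t ∈ Icc (x i) (x (i + 1)), w t = v) :
    |∑ j ∈ Finset.Icc 1 p, A i j * errorPrimitive N x w φ Q (g i j)| ≤
      2 * W * (M * h ^ (p + 2)) * ∫ t in (x i)..(x (i + 1)), w t := by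
  have hp := H.two_le
  have hlt := (H.lt i hi).le
  have hu : uIcc (x i) (x (i + 1)) = Icc (x i) (x (i + 1)) := uIcc_of_le hlt
  have hφi := hφ.mono (mesh_subset H.lt hi)
  obtain ⟨T, hTd, hTe⟩ := hT p (by omega) i hi
  obtain ⟨q, hq, hqd⟩ := exists_polynomial_antiderivative (Polynomial.C v * (T - Q i))
  have hqd' : (q - Polynomial.C (q.eval (x i))).natDegree ≤ 2 * p - 1 := by
    rw [Polynomial.natDegree_sub_C]
    have h1 : (T - Q i).natDegree ≤ p :=
      (Polynomial.natDegree_sub_le _ _).trans (max_le hTd ((hQ i hi).trans (by omega)))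
    have h2 := Polynomial.natDegree_C_mul_le v (T - Q i)
    omega
  have happrox : ∀ t ∈ Icc (x i) (x (i + 1)), |errorPrimitive N x w φ Q t -
      (q - Polynomial.C (q.eval (x i))).eval t| ≤ W * (M * h ^ (p + 2)) := by
    intro t ht
    have ht' : uIcc (x i) t ⊆ Icc (x i) (x (i + 1)) := by
      rw [uIcc_of_le ht.1]; exact Icc_subset_Icc le_rfl ht.2
    have i1 : IntervalIntegrable (fun s => (φ s - (Q i).eval s) * w s) volume (x i) t := by
      have hcc : ContinuousOn (fun s => φ s - (Q i).eval s) (uIcc (x i) t) :=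
        (hφi.mono ht').sub (Q i).continuous.continuousOn
      exact (H.intervalIntegrable _ _).continuousOn_mul hcc
    have e1 : errorPrimitive N x w φ Q t - (q - Polynomial.C (q.eval (x i))).eval t =
        ∫ s in (x i)..t, (φ s - T.eval s) * w s := by
      rw [H.errorPrimitive_eq hφ horth hi ht, Polynomial.eval_sub, Polynomial.eval_C,
        ← integral_derivative_eval, hq, ← intervalIntegral.integral_sub i1
          (Polynomial.continuous _).continuousOn.intervalIntegrable]
      refine integral_congr fun s hs => ?_
      simp only [Polynomial.eval_mul, Polynomial.eval_C, Polynomial.eval_sub, hv s (ht' hs)]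
      ring
    rw [e1]
    have h3 : 0 ≤ M * h ^ (p + 1) := by have := H.h_pos; positivity
    refine (abs_integral_le_mul_length (C := M * h ^ (p + 1) * W) ht.1 fun y hy => ?_).trans ?_
    · rw [abs_mul, abs_of_nonneg (H.nonneg y)]
      exact mul_le_mul (hTe y ⟨hy.1, hy.2.trans ht.2⟩) (H.le y) (H.nonneg y) h3
    · have h2 : t - x i ≤ h := by linarith [ht.2, H.step i hi]
      refine (mul_le_mul_of_nonneg_left h2 (mul_nonneg h3 H.W_nonneg)).trans (le_of_eq ?_)
      ring
  have h1 := gauss_quadrature_error hlt H.nonneg (H.intervalIntegrable _ _)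
    (H.mem i hi) (H.A_pos i hi) (H.quad i hi)
    ((H.errorPrimitive_continuousOn hφ).mono (mesh_subset H.lt hi)) hqd' happrox
  have h2 : ∫ t in (x i)..(x (i + 1)), errorPrimitive N x w φ Q t * w t = 0 := by
    have : ∫ t in (x i)..(x (i + 1)), errorPrimitive N x w φ Q t * w t =
        ∫ t in (x i)..(x (i + 1)), errorPrimitive N x w φ Q t * v :=
      integral_congr fun t ht => by rw [hu] at ht; simp only [hv t ht]
    rw [this, intervalIntegral.integral_mul_const,
      H.integral_errorPrimitive_element hφ horth hi, zero_mul]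
  rw [h2, sub_zero] at h1
  refine h1.trans (le_of_eq ?_)
  ring

lemma source_bounds (H : IsGaussMesh p N w W h κ x g A)
    (hφ : ContinuousOn φ (Icc (x 0) (x N))) (hQ : ∀ i < N, (Q i).natDegree ≤ p - 1)
    (horth : ∀ i < N, ∀ R : Polynomial ℝ, R.natDegree ≤ p - 1 →
      ∫ t in (x i)..(x (i + 1)), (φ t - (Q i).eval t) * R.eval t * w t = 0)
    (hM : 0 ≤ M) (hh : h ≤ 1)
    (hT : ∀ m ≤ p + 1, ∀ i < N, ∃ T : Polynomial ℝ, T.natDegree ≤ m ∧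
      ∀ t ∈ Icc (x i) (x (i + 1)), |φ t - T.eval t| ≤ M * h ^ (m + 1))
    {k : ℕ} (hk : ∀ i < N, i ≠ k → ∃ v, ∀ t ∈ Icc (x i) (x (i + 1)), w t = v)
    {γ c : ℝ} (hc : 0 ≤ c) {s : ℕ → Polynomial ℝ} (hs : ∀ i < N, (s i).natDegree ≤ p - 1)
    (hsg : ∀ i < N, ∀ j ∈ Finset.Icc 1 p, (s i).eval (g i j) =
      φ (g i j) - (Q i).eval (g i j) - γ * errorPrimitive N x w φ Q (g i j) -
        c * ∫ y in (x 0)..(g i j), errorPrimitive N x w φ Q y) :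
    (∀ i < N, ∀ j ∈ Finset.Icc 1 p, |(s i).eval (g i j)| ≤
      (2 * √(W / κ) + 2 * |γ| * W + 2 * c * W) * (M * h ^ (p + 1))) ∧
    ∀ t ∈ Icc (x 0) (x N), |∫ y in (x 0)..t, piecewisePoly N x s y * w y| ≤
      ((2 + 2 * |γ| * W + 2 * c * W) * (W * (x N - x 0)) +
        2 * ((2 * √(W / κ) + 2 * |γ| * W + 2 * c * W) * W)) * (M * h ^ (p + 2)) := by
  have hp := H.two_le
  have hh0 := H.h_pos
  have hW := H.W_nonneg
  have hx := H.lt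
  set K := 2 * √(W / κ) + 2 * |γ| * W + 2 * c * W with hK
  set K' := 2 + 2 * |γ| * W + 2 * c * W with hK'
  have hK0 : 0 ≤ K := by positivity
  have hK'0 : 0 ≤ K' := by positivity
  have hpow : h ^ (p + 2) ≤ h ^ (p + 1) := pow_le_pow_of_le_one hh0.le hh (by omega)
  have hη := fun {t : ℝ} (ht : t ∈ Icc (x 0) (x N)) =>
    H.abs_errorPrimitive_le hφ hQ horth hM hT ht
  have hηi := fun {t : ℝ} (ht : t ∈ Icc (x 0) (x N)) =>
    H.abs_integral_errorPrimitive_le hφ hQ horth hM hT ht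
  have hsb : ∀ i < N, ∀ j ∈ Finset.Icc 1 p, |(s i).eval (g i j)| ≤ K * (M * h ^ (p + 1)) := by
    intro i hi j hj
    have mg := mesh_subset hx hi (H.mem i hi j hj)
    rw [hsg i hi j hj]
    refine (abs_sub _ _).trans ((add_le_add_left (abs_sub _ _) _).trans ?_)
    rw [abs_mul, abs_mul, abs_of_nonneg hc]
    have b1 := H.abs_nodal_error_le hφ hQ horth hT hi hj
    have b2 := mul_le_mul_of_nonneg_left (hη mg) (abs_nonneg γ)
    have b3 := mul_le_mul_of_nonneg_left (hηi mg) hc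
    have b4 : c * (2 * W * (M * h ^ (p + 2))) ≤ c * (2 * W * (M * h ^ (p + 1))) := by gcongr
    rw [hK]
    linarith
  refine ⟨hsb, ?_⟩
  have habs : ∀ i < N, ∫ t in (x i)..(x (i + 1)), |(s i).eval t| * w t ≤
      K * W * (M * h ^ (p + 2)) := by
    intro i hi
    refine (gauss_integral_abs_le (by omega) (hx i hi).le H.nonneg (H.intervalIntegrable _ _)
      (H.A_pos i hi) (H.quad i hi) (hs i hi) (hsb i hi)).trans ?_
    have h1 : ∫ t in (x i)..(x (i + 1)), w t ≤ W * h :=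
      (H.integral_le (hx i hi).le).trans (mul_le_mul_of_nonneg_left (H.step i hi) hW)
    refine (mul_le_mul_of_nonneg_left h1 (by positivity)).trans (le_of_eq ?_)
    ring
  have hpart : ∀ i < N, ∀ t ∈ Icc (x i) (x (i + 1)),
      |∫ y in (x i)..t, (s i).eval y * w y| ≤ K * W * (M * h ^ (p + 2)) := fun i hi t ht =>
    H.abs_integral_mul_le_element ((H.intervalIntegrable _ _).continuousOn_mul
      (s i).continuous.continuousOn) (habs i hi) ht
  have hfull : ∀ i < N, i ≠ k → |∫ y in (x i)..(x (i + 1)), (s i).eval y * w y| ≤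
      K' * (M * h ^ (p + 2)) * ∫ y in (x i)..(x (i + 1)), w y := by
    intro i hi hik
    obtain ⟨v, hv⟩ := hk i hi hik
    rw [← H.quad i hi (s i) ((hs i hi).trans (by omega))]
    have e1 : ∑ j ∈ Finset.Icc 1 p, A i j * (s i).eval (g i j) =
        ∑ j ∈ Finset.Icc 1 p, A i j * (φ (g i j) - (Q i).eval (g i j)) -
        γ * ∑ j ∈ Finset.Icc 1 p, A i j * errorPrimitive N x w φ Q (g i j) -
        c * ∑ j ∈ Finset.Icc 1 p, A i j *
          ∫ y in (x 0)..(g i j), errorPrimitive N x w φ Q y := by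
      rw [Finset.mul_sum, Finset.mul_sum, ← Finset.sum_sub_distrib, ← Finset.sum_sub_distrib]
      refine Finset.sum_congr rfl fun j hj => ?_
      rw [hsg i hi j hj]
      ring
    rw [e1]
    refine (abs_sub _ _).trans ((add_le_add_left (abs_sub _ _) _).trans ?_)
    rw [abs_mul γ, abs_mul c, abs_of_nonneg hc]
    have b1 := H.abs_quadrature_nodal_error_le hφ hQ horth hT hi
    have b2 := mul_le_mul_of_nonneg_left
      (H.abs_quadrature_errorPrimitive_le hφ hQ horth hM hT hi hv) (abs_nonneg γ)
    have b3 : |∑ j ∈ Finset.Icc 1 p, A i j * ∫ y in (x 0)..(g i j), errorPrimitive N x w φ Q y|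
        ≤ 2 * W * (M * h ^ (p + 2)) * ∫ t in (x i)..(x (i + 1)), w t := by
      rw [← gauss_sum_weights (H.quad i hi), Finset.mul_sum]
      refine (Finset.abs_sum_le_sum_abs _ _).trans (Finset.sum_le_sum fun j hj => ?_)
      rw [abs_mul, abs_of_pos (H.A_pos i hi j hj), mul_comm]
      exact mul_le_mul_of_nonneg_right (hηi (mesh_subset hx hi (H.mem i hi j hj)))
        (H.A_pos i hi j hj).le
    have b4 := mul_le_mul_of_nonneg_left b3 hc
    rw [hK']
    linarith
  have h0 : x 0 ∈ Icc (x 0) (x N) := ⟨le_rfl, H.zero_lt.le⟩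
  have pint : ∀ {a b : ℝ}, a ∈ Icc (x 0) (x N) → b ∈ Icc (x 0) (x N) →
      IntervalIntegrable (fun t => piecewisePoly N x s t * w t) volume a b :=
    piecewisePoly_mul_intervalIntegrable hx H.intervalIntegrable s
  have hnode : ∀ n ≤ N, |∫ y in (x 0)..(x n), piecewisePoly N x s y * w y| ≤
      K' * (M * h ^ (p + 2)) * (∫ y in (x 0)..(x n), w y) +
        if k < n then K * W * (M * h ^ (p + 2)) else 0 := by
    intro n
    induction n with
    | zero => intro _; simp
    | succ n ih =>
      intro hn
      have hi : n < N := by omega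
      have hsub := mesh_subset hx hi
      have h1 : x n ∈ Icc (x 0) (x N) := hsub ⟨le_rfl, (hx n hi).le⟩
      have h2 : x (n + 1) ∈ Icc (x 0) (x N) := hsub ⟨(hx n hi).le, le_rfl⟩
      rw [← integral_add_adjacent_intervals (pint h0 h1) (pint h1 h2),
        ← integral_add_adjacent_intervals (H.intervalIntegrable (x 0) (x n))
          (H.intervalIntegrable (x n) (x (n + 1))),
        integral_piecewisePoly_mul hx w s hi ⟨(hx n hi).le, le_rfl⟩]
      refine (abs_add_le _ _).trans ?_
      have b0 := ih hi.le
      have b1 : 0 ≤ K' * (M * h ^ (p + 2)) * ∫ y in (x n)..(x (n + 1)), w y :=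
        mul_nonneg (by positivity) (H.integral_nonneg (hx n hi).le)
      by_cases hkn : n = k
      · subst hkn
        rw [if_neg (lt_irrefl _)] at b0
        rw [if_pos (Nat.lt_succ_self _)]
        have b2 := hpart n hi (x (n + 1)) ⟨(hx n hi).le, le_rfl⟩
        linarith
      · have b2 := hfull n hi hkn
        have e2 : (k < n + 1) = (k < n) := by
          apply propext; omega
        simp only [e2]
        linarith
  intro t ht
  obtain ⟨i, hi, hti⟩ := exists_mem_element H.pos ht
  have hsub := mesh_subset hx hi
  have h1 : x i ∈ Icc (x 0) (x N) := hsub ⟨le_rfl, (hx i hi).le⟩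
  rw [← integral_add_adjacent_intervals (pint h0 h1) (pint h1 ht),
    integral_piecewisePoly_mul hx w s hi hti]
  refine (abs_add_le _ _).trans ?_
  have b1 := hnode i hi.le
  have b2 := hpart i hi t hti
  have b3 : ∫ y in (x 0)..(x i), w y ≤ W * (x N - x 0) :=
    (H.integral_le h1.1).trans (mul_le_mul_of_nonneg_left (by linarith [h1.2]) hW)
  have b4 := mul_le_mul_of_nonneg_left b3 (show 0 ≤ K' * (M * h ^ (p + 2)) by positivity)
  have b5 : (if k < i then K * W * (M * h ^ (p + 2)) else 0) ≤ K * W * (M * h ^ (p + 2)) := by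
    split_ifs
    · exact le_rfl
    · positivity
  linarith

end Projection

end IsGaussMesh

lemma exists_absorption_constants {G Γ c K₁ K₂ L₀ L₁ : ℝ} (hG : 0 ≤ G) (hΓ : 0 ≤ Γ) (hc : 0 ≤ c)
    (hK₁ : 0 ≤ K₁) (hK₂ : 0 ≤ K₂) (hL₀ : 0 < L₀) (hL₁ : 0 ≤ L₁) :
    ∃ h₀ C : ℝ, 0 < h₀ ∧ h₀ ≤ 1 ∧ 0 ≤ C ∧ ∀ h q k B₁ M L R : ℝ, 0 ≤ h → h ≤ h₀ → 0 ≤ q → 0 ≤ R →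
      L₀ ≤ L → L ≤ L₁ → B₁ * h = K₁ * q →
      R = 2 * (G * h * (k + Γ * M + B₁) + c * (h * M) + 2 * Γ * (K₂ * q)) →
      k ≤ (Γ * L + 1) * R + K₂ * q / L → M ≤ L * R + 2 * (K₂ * q) →
      L * R + 2 * (K₂ * q) ≤ C * q := by
  set K := 2 * G * (2 * Γ * L₁ + 1) + 2 * c * L₁ with hK
  set D := (2 * G * (1 / L₀ + 2 * Γ) + 4 * c + 4 * Γ) * K₂ + 2 * G * K₁ with hD
  have hK0 : 0 ≤ K := by positivity
  have hD0 : 0 ≤ D := by positivity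
  have hden : 0 < 2 * K + 1 := by positivity
  refine ⟨1 / (2 * K + 1), 2 * L₁ * D + 2 * K₂, by positivity, ?_, by positivity, ?_⟩
  · rw [div_le_one hden]; linarith
  intro h q k B₁ M L R hh hh₀ hq hR hLL hLU hB hRe hk hM
  have hh1 : h ≤ 1 := hh₀.trans (by rw [div_le_one hden]; linarith)
  have hhK : h * K ≤ 1 / 2 := by
    rw [le_div_iff₀ hden] at hh₀
    nlinarith
  have hLp : 0 < L := hL₀.trans_le hLL
  have hdiv : K₂ * q / L ≤ 1 / L₀ * (K₂ * q) := by
    rw [div_eq_mul_one_div, mul_comm]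
    exact mul_le_mul_of_nonneg_right (one_div_le_one_div_of_le hL₀ hLL) (by positivity)
  have hLR : L * R ≤ L₁ * R := mul_le_mul_of_nonneg_right hLU hR
  have hM' : M ≤ L₁ * R + 2 * (K₂ * q) := hM.trans (by linarith)
  have hk' : k ≤ (Γ * L₁ + 1) * R + 1 / L₀ * (K₂ * q) := by
    have := mul_le_mul_of_nonneg_left hLR hΓ
    linarith
  have hGh : 0 ≤ G * h := by positivity
  have hch : 0 ≤ c * h := by positivity
  have e1 := mul_le_mul_of_nonneg_left hk' hGh
  have e2 := mul_le_mul_of_nonneg_left (mul_le_mul_of_nonneg_left hM' hΓ) hGh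
  have e3 := mul_le_mul_of_nonneg_left hM' hch
  have e4 : G * h * B₁ = G * (K₁ * q) := by rw [← hB]; ring
  have hX : 0 ≤ G * (1 / L₀ * (K₂ * q) + 2 * Γ * (K₂ * q)) + 2 * c * (K₂ * q) := by positivity
  have e5 := mul_le_of_le_one_left hX hh1
  have hR2 : R ≤ h * K * R + D * q := by
    rw [hK, hD]
    linarith
  have e6 := mul_le_mul_of_nonneg_right hhK hR
  have hR3 : R ≤ 2 * (D * q) := by linarith
  have e7 := mul_le_mul_of_nonneg_left hR3 hL₁
  linarith

lemma exists_superclose_constants {p : ℕ} {W κ γ c d L₀ : ℝ} (hW : 0 ≤ W) (hc : 0 ≤ c)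
    (hd : 0 < d) (hL₀ : 0 < L₀) :
    ∃ h₀ C : ℝ, 0 < h₀ ∧ 0 ≤ C ∧ ∀ {N k : ℕ} {h M κ' : ℝ} {w φ e : ℝ → ℝ} {x : ℕ → ℝ}
      {g A : ℕ → ℕ → ℝ} {P Q : ℕ → Polynomial ℝ}, IsGaussMesh p N w W h κ x g A →
      x N - x 0 = d → L₀ ≤ ∫ t in (x 0)..(x N), w t → h ≤ h₀ →
      ContinuousOn φ (Icc (x 0) (x N)) →
      (∀ i < N, (P i).natDegree ≤ p - 1) → (∀ i < N, (Q i).natDegree ≤ p - 1) →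
      (∀ i < N, ∀ R : Polynomial ℝ, R.natDegree ≤ p - 1 →
        ∫ t in (x i)..(x (i + 1)), (φ t - (Q i).eval t) * R.eval t * w t = 0) →
      0 ≤ M →
      (∀ m ≤ p + 1, ∀ i < N, ∃ T : Polynomial ℝ, T.natDegree ≤ m ∧
        ∀ t ∈ Icc (x i) (x (i + 1)), |φ t - T.eval t| ≤ M * h ^ (m + 1)) →
      (∀ i < N, i ≠ k → ∃ v, ∀ t ∈ Icc (x i) (x (i + 1)), w t = v) →
      (∀ t ∈ Icc (x 0) (x N), e t = ∫ y in (x 0)..t,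
        (piecewisePoly N x P y - piecewisePoly N x Q y) * w y) →
      e (x N) = 0 →
      (∀ i < N, ∀ j ∈ Finset.Icc 1 p, (P i).eval (g i j) - φ (g i j) = κ' +
        γ * (e (g i j) - IsGaussMesh.errorPrimitive N x w φ Q (g i j)) +
        c * ∫ y in (x 0)..(g i j), (e y - IsGaussMesh.errorPrimitive N x w φ Q y)) →
      ∀ t ∈ Icc (x 0) (x N), |e t| ≤ C * (M * h ^ (p + 2)) := by
  obtain ⟨h₀, C, hh₀, hh₀1, hC, hmain⟩ := exists_absorption_constants
    (G := |γ| * W) (Γ := |γ| + c * d) (c := c)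
    (K₁ := 2 * √(W / κ) + 2 * |γ| * W + 2 * c * W)
    (K₂ := (2 + 2 * |γ| * W + 2 * c * W) * (W * d) +
        2 * ((2 * √(W / κ) + 2 * |γ| * W + 2 * c * W) * W)) (L₀ := L₀) (L₁ := W * d)
    (by positivity) (by positivity) hc (by positivity) (by positivity) hL₀ (by positivity)
  refine ⟨h₀, C, hh₀, hC, ?_⟩
  intro N k h M κ' w φ e x g A P Q H hxd hLw hhle hφ hP hQ horth hM hT hk he heN hnod
  have hh1 : h ≤ 1 := hhle.trans hh₀1
  have h0N := H.zero_lt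
  have m0 : x 0 ∈ Icc (x 0) (x N) := ⟨le_rfl, h0N.le⟩
  have pint : ∀ P : ℕ → Polynomial ℝ, ∀ {a b : ℝ}, a ∈ Icc (x 0) (x N) → b ∈ Icc (x 0) (x N) →
      IntervalIntegrable (fun t => piecewisePoly N x P t * w t) volume a b := fun P _ _ ha hb =>
    piecewisePoly_mul_intervalIntegrable H.lt H.intervalIntegrable P ha hb
  have hηc := H.errorPrimitive_continuousOn (Q := Q) hφ
  have hec : ContinuousOn e (Icc (x 0) (x N)) := by
    have h1 : IntervalIntegrable
        (fun y => (piecewisePoly N x P y - piecewisePoly N x Q y) * w y) volume (x 0) (x N) :=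
      ((pint P m0 ⟨h0N.le, le_rfl⟩).sub (pint Q m0 ⟨h0N.le, le_rfl⟩)).congr fun y _ => by ring
    have h2 := continuousOn_primitive_interval' h1 (a := x 0) (by simp)
    rw [uIcc_of_le h0N.le] at h2
    exact h2.congr he
  have hs : ∀ i, ∃ s : Polynomial ℝ, i < N → s.natDegree ≤ p - 1 ∧ ∀ j ∈ Finset.Icc 1 p,
      s.eval (g i j) = φ (g i j) - (Q i).eval (g i j) -
        γ * IsGaussMesh.errorPrimitive N x w φ Q (g i j) -
        c * ∫ y in (x 0)..(g i j), IsGaussMesh.errorPrimitive N x w φ Q y := by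
    intro i
    by_cases hi : i < N
    · obtain ⟨s, hs⟩ := exists_interpolant (H.inj i hi) fun j => φ (g i j) - (Q i).eval (g i j) -
        γ * IsGaussMesh.errorPrimitive N x w φ Q (g i j) -
        c * ∫ y in (x 0)..(g i j), IsGaussMesh.errorPrimitive N x w φ Q y
      exact ⟨s, fun _ => hs⟩
    · exact ⟨0, fun h => absurd h hi⟩
  choose s hs using hs
  have hsd := fun i hi => (hs i hi).1
  have hsg := fun i hi => (hs i hi).2
  obtain ⟨hB₁, hB₂⟩ := H.source_bounds hφ hQ horth hM hh1 hT hk hc hsd hsg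
  have hsplit : ∀ t ∈ Icc (x 0) (x N), e t =
      (∫ y in (x 0)..t, piecewisePoly N x (fun i => P i - Q i - s i) y * w y) +
      ∫ y in (x 0)..t, piecewisePoly N x s y * w y := by
    intro t ht
    rw [he t ht, ← intervalIntegral.integral_add (pint _ m0 ht) (pint _ m0 ht)]
    refine integral_congr fun y _ => ?_
    simp only [piecewisePoly, Polynomial.eval_sub]
    ring
  obtain ⟨t₀, ht₀, hmax⟩ := isCompact_Icc.exists_isMaxOn ⟨x 0, m0⟩ hec.abs
  have hmesh : ∀ i < N, ∀ j ∈ Finset.Icc 1 p, (P i - Q i - s i).eval (g i j) =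
      κ' + γ * e (g i j) + c * ∫ y in (x 0)..(g i j), e y := by
    intro i hi j hj
    have mg := mesh_subset H.lt hi (H.mem i hi j hj)
    have hsub : uIcc (x 0) (g i j) ⊆ Icc (x 0) (x N) := uIcc_subset_Icc m0 mg
    have h1 := hnod i hi j hj
    rw [intervalIntegral.integral_sub (hec.mono hsub).intervalIntegrable
      (hηc.mono hsub).intervalIntegrable] at h1
    rw [Polynomial.eval_sub, Polynomial.eval_sub, hsg i hi j hj]
    linarith
  have hLle := H.integral_le h0N.le
  rw [hxd] at hLle
  obtain ⟨R, hR, hRe, hκ', hfin⟩ := H.stability hc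
    (fun i hi => (Polynomial.natDegree_sub_le _ _).trans
      (max_le ((Polynomial.natDegree_sub_le _ _).trans (max_le (hP i hi) (hQ i hi))) (hsd i hi)))
    hsd hsplit heN hmesh hB₁ hB₂ (fun t ht => hmax ht) rfl (hL₀.trans_le hLw)
  rw [hxd] at hRe hκ' hfin
  intro t ht
  refine (hfin t ht).trans (hmain h (M * h ^ (p + 2)) |κ'|
    ((2 * √(W / κ) + 2 * |γ| * W + 2 * c * W) * (M * h ^ (p + 1))) (|e t₀|) _ R H.h_pos.le hhle
    (by have := H.h_pos; positivity) hR hLw hLle ?_ (hRe.trans ?_) hκ' (hfin t₀ ht₀))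
  · ring
  · ring

lemma exists_taylor_polynomial {l r h M : ℝ} (hlr : l ≤ r) (hh : r - l ≤ h) (hM : 0 ≤ M) (m : ℕ)
    {F : ℕ → ℝ → ℝ}
    (hF : ∀ j ≤ m, ∀ t ∈ Icc l r, HasDerivWithinAt (F j) (F (j + 1) t) (Icc l r) t)
    (hb : ∀ t ∈ Icc l r, |F (m + 1) t| ≤ M) :
    ∃ T : Polynomial ℝ, T.natDegree ≤ m ∧ ∀ t ∈ Icc l r, |F 0 t - T.eval t| ≤ M * h ^ (m + 1) := by
  have hh0 : 0 ≤ h := (sub_nonneg.2 hlr).trans hh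
  have key : ∀ {G G' : ℝ → ℝ} {B : ℝ}, 0 ≤ B →
      (∀ t ∈ Icc l r, HasDerivWithinAt G (G' t) (Icc l r) t) →
      (∀ t ∈ Icc l r, |G' t| ≤ B) → ∀ t ∈ Icc l r, |G t - G l| ≤ B * h := by
    intro G G' B hB hG hG' t ht
    have h1 := (convex_Icc l r).norm_image_sub_le_of_norm_hasDerivWithin_le hG hG'
      ⟨le_rfl, hlr⟩ ht
    refine h1.trans (mul_le_mul_of_nonneg_left ?_ hB)
    rw [Real.norm_eq_abs, abs_of_nonneg (by linarith [ht.1])]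
    linarith [ht.2]
  induction m generalizing F with
  | zero =>
    refine ⟨Polynomial.C (F 0 l), by simp, fun t ht => ?_⟩
    rw [Polynomial.eval_C, zero_add, pow_one]
    exact key hM (hF 0 le_rfl) hb t ht
  | succ m ih =>
    obtain ⟨T, hTd, hT⟩ := ih (F := fun j => F (j + 1)) (fun j hj => hF (j + 1) (by omega)) hb
    obtain ⟨q, hq, hqd⟩ := exists_polynomial_antiderivative T
    refine ⟨q - Polynomial.C (q.eval l - F 0 l), ?_, fun t ht => ?_⟩
    · rw [Polynomial.natDegree_sub_C]; omega
    · have := key (G := fun t => F 0 t - q.eval t) (B := M * h ^ (m + 1)) (by positivity) (fun t ht =>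
        (hF 0 (Nat.zero_le _) t ht).sub (q.hasDerivAt t).hasDerivWithinAt)
        (by rw [hq]; exact hT) t ht
      rw [Polynomial.eval_sub, Polynomial.eval_C, pow_succ _ (m + 1), ← mul_assoc]
      convert this using 2
      ring

lemma integral_deriv_off_countable {a b : ℝ} {v v' : ℝ → ℝ} {S : Set ℝ} (hS : S.Countable)
    (hv : ContinuousOn v (Icc a b)) (hd : ∀ t ∈ Ioo a b \ S, HasDerivAt v (v' t) t)
    (hi : ∀ s ∈ Icc a b, ∀ t ∈ Icc a b, IntervalIntegrable v' volume s t) {s t : ℝ}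
    (hs : s ∈ Icc a b) (ht : t ∈ Icc a b) :
    IntervalIntegrable (deriv v) volume s t ∧ ∫ y in s..t, deriv v y = v t - v s ∧
      ∫ y in s..t, v' y = v t - v s := by
  have hS' : (S ∪ {a, b}).Countable := hS.union (Set.to_countable _)
  have hae : v' =ᵐ[volume.restrict (uIoc s t)] deriv v := by
    refine (ae_restrict_iff' measurableSet_uIoc).2 ?_
    have : ∀ᵐ y : ℝ, y ∉ S ∪ {a, b} := by
      have h0 : volume (S ∪ {a, b}) = 0 := hS'.measure_zero _
      exact measure_eq_zero_iff_ae_notMem.1 h0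
    filter_upwards [this] with y hy hy'
    have h1 : y ∈ Icc a b := uIcc_subset_Icc hs ht (uIoc_subset_uIcc hy')
    simp only [mem_union, mem_insert_iff, mem_singleton_iff, not_or] at hy
    exact (hd y ⟨⟨lt_of_le_of_ne h1.1 (Ne.symm hy.2.1), lt_of_le_of_ne h1.2 hy.2.2⟩, hy.1⟩).deriv.symm
  have h1 : ∫ y in s..t, v' y = v t - v s := by
    refine integral_eq_of_hasDerivAt_off_countable v v' hS (hv.mono (uIcc_subset_Icc hs ht))
      (fun y hy => hd y ⟨?_, hy.2⟩) (hi s hs t ht)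
    exact Ioo_subset_Ioo (le_min hs.1 ht.1) (max_le hs.2 ht.2) hy.1
  refine ⟨(hi s hs t ht).congr_ae hae, ?_, h1⟩
  rw [← h1]
  refine integral_congr_ae ?_
  have := (ae_restrict_iff' measurableSet_uIoc).1 hae
  filter_upwards [this] with y hy hy' using (hy hy').symm

lemma flux_polynomial_eq {p : ℕ} {α βm βp : ℝ} (hp : 1 ≤ p) {qm qp : Polynomial ℝ}
    (hqm : qm.natDegree ≤ p) (hqp : qp.natDegree ≤ p)
    (h : ∀ j, 1 ≤ j → j ≤ p → βm * ((⇑Polynomial.derivative)^[j] qm).eval α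
        = βp * ((⇑Polynomial.derivative)^[j] qp).eval α) :
    Polynomial.C βm * Polynomial.derivative qm = Polynomial.C βp * Polynomial.derivative qp := by
  rw [← sub_eq_zero]
  set R := Polynomial.C βm * Polynomial.derivative qm - Polynomial.C βp * Polynomial.derivative qp
    with hR
  have hdeg : R.natDegree ≤ p - 1 := by
    refine (Polynomial.natDegree_sub_le _ _).trans (max_le ?_ ?_)
    · refine (Polynomial.natDegree_C_mul_le _ _).trans ?_
      have := Polynomial.natDegree_derivative_le qm
      omega
    · refine (Polynomial.natDegree_C_mul_le _ _).trans ?_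
      have := Polynomial.natDegree_derivative_le qp
      omega
  have hD : ∀ j, ((⇑Polynomial.derivative)^[j] R).eval α = 0 := by
    intro j
    by_cases hj : j < p
    · have := h (j + 1) (by omega) (by omega)
      rw [hR, Polynomial.iterate_derivative_sub, Polynomial.iterate_derivative_C_mul,
        Polynomial.iterate_derivative_C_mul, ← Function.iterate_succ_apply,
        ← Function.iterate_succ_apply]
      simp only [Polynomial.eval_sub, Polynomial.eval_mul, Polynomial.eval_C]
      linarith
    · rw [Polynomial.iterate_derivative_eq_zero (by omega)]
      simp
  refine Polynomial.eq_zero_of_hasseDeriv_eq_zero R α fun j => ?_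
  have h1 := congrArg (fun f => (f R).eval α) (Polynomial.factorial_smul_hasseDeriv (R := ℝ) j)
  have h2 : ((⇑Polynomial.derivative)^[j] R).eval α = 0 := hD j
  simp only [LinearMap.smul_apply, Polynomial.eval_smul] at h1
  have h3 : (j.factorial : ℝ) * ((Polynomial.hasseDeriv j) R).eval α = 0 := by
    rw [← h2]; simpa using h1
  exact (mul_eq_zero.1 h3).resolve_left (by positivity)

section Interface

variable {a b α βm βp : ℝ}

lemma betaPW_of_lt {t : ℝ} (h : t < α) : betaPW βm βp α t = βm := if_pos h

lemma betaPW_of_le {t : ℝ} (h : α ≤ t) : betaPW βm βp α t = βp := if_neg (not_lt.2 h)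

lemma betaPW_eq_or (t : ℝ) : betaPW βm βp α t = βm ∨ betaPW βm βp α t = βp := by
  unfold betaPW; split_ifs <;> simp

lemma betaPW_pos (hβm : 0 < βm) (hβp : 0 < βp) (t : ℝ) : 0 < betaPW βm βp α t := by
  rcases betaPW_eq_or (βm := βm) (βp := βp) (α := α) t with h | h <;> rw [h] <;> assumption

lemma betaPW_le (t : ℝ) : betaPW βm βp α t ≤ max βm βp := by
  rcases betaPW_eq_or (βm := βm) (βp := βp) (α := α) t with h | h <;> rw [h] <;> simp

lemma le_betaPW (t : ℝ) : min βm βp ≤ betaPW βm βp α t := by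
  rcases betaPW_eq_or (βm := βm) (βp := βp) (α := α) t with h | h <;> rw [h] <;> simp

lemma measurable_betaPW : Measurable (betaPW βm βp α) :=
  Measurable.ite measurableSet_Iio measurable_const measurable_const

lemma betaPW_eventuallyEq {t : ℝ} (ht : t ≠ α) :
    ∀ᶠ s in nhds t, betaPW βm βp α s = betaPW βm βp α t := by
  rcases lt_or_gt_of_ne ht with h | h
  · filter_upwards [Iio_mem_nhds h] with s hs
    rw [betaPW_of_lt h, betaPW_of_lt hs]
  · filter_upwards [Ioi_mem_nhds h] with s hs
    rw [betaPW_of_le h.le, betaPW_of_le (le_of_lt hs)]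

/-- The weighted flux of a function in the immersed trial space is a piecewise polynomial. -/
lemma exists_flux_polynomials {p N k : ℕ} {x : ℕ → ℝ} {v : ℝ → ℝ} (hβm : 0 < βm) (hβp : 0 < βp)
    (hp : 1 ≤ p) (hx : ∀ i < N, x i < x (i + 1)) (hk : 1 ≤ k) (hkN : k ≤ N)
    (hα : x (k - 1) < α) (hα' : α < x k)
    (hel : ∀ i, 1 ≤ i → i ≤ N → i ≠ k → ∃ q : Polynomial ℝ, q.natDegree ≤ p ∧
      ∀ y ∈ Icc (x (i - 1)) (x i), v y = q.eval y)
    (hint : ∃ qm qp : Polynomial ℝ, qm.natDegree ≤ p ∧ qp.natDegree ≤ p ∧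
      (∀ y ∈ Icc (x (k - 1)) α, v y = qm.eval y) ∧
      (∀ y ∈ Icc α (x k), v y = qp.eval y) ∧
      ∀ j, 1 ≤ j → j ≤ p →
        βm * ((⇑Polynomial.derivative)^[j] qm).eval α
          = βp * ((⇑Polynomial.derivative)^[j] qp).eval α) :
    ∃ P : ℕ → Polynomial ℝ, (∀ i < N, (P i).natDegree ≤ p - 1) ∧
      ∀ i < N, ∀ t ∈ Ioo (x i) (x (i + 1)), t ≠ α →
        HasDerivAt v ((P i).eval t * (betaPW βm βp α t)⁻¹) t := by
  have hpoly : ∀ {q : Polynomial ℝ} {l r : ℝ} {β t : ℝ}, 0 < β → t ∈ Ioo l r →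
      betaPW βm βp α t = β → (∀ y ∈ Icc l r, v y = q.eval y) →
      HasDerivAt v ((Polynomial.C β * Polynomial.derivative q).eval t *
        (betaPW βm βp α t)⁻¹) t := by
    intro q l r β t hβ ht hbt hv
    rw [hbt, Polynomial.eval_mul, Polynomial.eval_C, mul_comm β, mul_assoc,
      mul_inv_cancel₀ hβ.ne', mul_one]
    refine (q.hasDerivAt t).congr_of_eventuallyEq ?_
    filter_upwards [Ioo_mem_nhds ht.1 ht.2] with y hy using hv y ⟨hy.1.le, hy.2.le⟩
  have hdeg : ∀ {q : Polynomial ℝ} {β : ℝ}, q.natDegree ≤ p →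
      (Polynomial.C β * Polynomial.derivative q).natDegree ≤ p - 1 := by
    intro q β hq
    refine (Polynomial.natDegree_C_mul_le _ _).trans ?_
    have := Polynomial.natDegree_derivative_le q
    omega
  have hex : ∀ i, ∃ P : Polynomial ℝ, i < N → P.natDegree ≤ p - 1 ∧
      ∀ t ∈ Ioo (x i) (x (i + 1)), t ≠ α →
        HasDerivAt v (P.eval t * (betaPW βm βp α t)⁻¹) t := by
    intro i
    by_cases hi : i < N
    · by_cases hik : i + 1 = k
      · obtain ⟨qm, qp, hqm, hqp, hvm, hvp, hj⟩ := hint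
        subst hik
        refine ⟨Polynomial.C βm * Polynomial.derivative qm, fun _ => ⟨hdeg hqm, fun t ht htα => ?_⟩⟩
        rw [Nat.add_sub_cancel] at hα hvm
        rcases lt_or_gt_of_ne htα with h | h
        · exact hpoly hβm ⟨ht.1, h⟩ (betaPW_of_lt h) hvm
        · rw [flux_polynomial_eq hp hqm hqp hj]
          exact hpoly hβp ⟨h, ht.2⟩ (betaPW_of_le h.le) hvp
      · obtain ⟨q, hq, hv⟩ := hel (i + 1) (by omega) (by omega) hik
        rw [Nat.add_sub_cancel] at hv
        rcases lt_or_ge (i + 1) k with h | h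
        · refine ⟨Polynomial.C βm * Polynomial.derivative q, fun _ => ⟨hdeg hq, fun t ht _ => ?_⟩⟩
          have h1 : x (i + 1) ≤ x (k - 1) := mesh_mono hx (by omega) (by omega)
          exact hpoly hβm ht (betaPW_of_lt (by linarith [ht.2])) hv
        · refine ⟨Polynomial.C βp * Polynomial.derivative q, fun _ => ⟨hdeg hq, fun t ht _ => ?_⟩⟩
          have h1 : x k ≤ x i := mesh_mono hx (by omega) (by omega)
          exact hpoly hβp ht (betaPW_of_le (by linarith [ht.1])) hv
    · exact ⟨0, fun h => absurd h hi⟩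
  choose P hP using hex
  exact ⟨P, fun i hi => (hP i hi).1, fun i hi => (hP i hi).2⟩

lemma iteratedDerivWithin_abs_le {m : ℕ} {u : ℝ → ℝ} {l r : ℝ} (hlr : l < r)
    (hu : ContDiffOn ℝ (m : ℕ∞) u (Icc l r)) {j : ℕ} (hj : j ≤ m) {t : ℝ} (ht : t ∈ Icc l r) :
    |iteratedDerivWithin j u (Icc l r) t| ≤ sSup {y : ℝ | ∃ j ≤ m, ∃ t ∈ Icc l r,
      y = |iteratedDerivWithin j u (Icc l r) t|} := by
  refine le_csSup ?_ ⟨j, hj, t, ht, rfl⟩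
  have hB : ∀ j ≤ m, ∃ B, ∀ t ∈ Icc l r, |iteratedDerivWithin j u (Icc l r) t| ≤ B := by
    intro j hj
    have hc := hu.continuousOn_iteratedDerivWithin (by exact_mod_cast hj)
      (uniqueDiffOn_Icc hlr)
    exact isCompact_Icc.exists_bound_of_continuousOn hc
  choose! B hB using hB
  refine ⟨∑ j ∈ Finset.range (m + 1), |B j|, ?_⟩
  rintro y ⟨j, hj, t, ht, rfl⟩
  refine (hB j hj t ht).trans ((le_abs_self _).trans ?_)
  exact Finset.single_le_sum (f := fun j => |B j|) (fun i _ => abs_nonneg _)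
    (Finset.mem_range.2 (by omega))

lemma wnorm_nonneg (m : ℕ) (u : ℝ → ℝ) : 0 ≤ wnorm m a b α u := by
  refine le_max_of_le_left (Real.sSup_nonneg ?_)
  rintro y ⟨j, _, t, _, rfl⟩
  exact abs_nonneg _

/-- The flux of a function in the broken space has a continuous chain of derivatives across the
interface. -/
lemma MemW.exists_flux {m : ℕ} {u : ℝ → ℝ} (hu : MemW (m + 1) a b α βm βp u) (hβm : 0 < βm)
    (hβp : 0 < βp) (haα : a < α) (hαb : α < b) :
    ∃ F : ℕ → ℝ → ℝ,
      (∀ j < m, ∀ t ∈ Icc a b, HasDerivWithinAt (F j) (F (j + 1) t) (Icc a b) t) ∧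
      (∀ j ≤ m, ∀ t ∈ Icc a b, |F j t| ≤ max βm βp * wnorm (m + 1) a b α u) ∧
      ∀ t ∈ Ioo a b, t ≠ α → HasDerivAt u (F 0 t * (betaPW βm βp α t)⁻¹) t := by
  obtain ⟨-, -, -, hum, hup, hj⟩ := hu
  set D := fun (j : ℕ) (s : Set ℝ) (t : ℝ) => iteratedDerivWithin j u s t with hD
  have hder : ∀ {l r : ℝ}, l < r → ContDiffOn ℝ ((m + 1 : ℕ) : ℕ∞) u (Icc l r) →
      ∀ j ≤ m, ∀ t ∈ Icc l r, HasDerivWithinAt (D j (Icc l r)) (D (j + 1) (Icc l r) t)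
        (Icc l r) t := by
    intro l r hlr hc j hj t ht
    have h1 := hc.differentiableOn_iteratedDerivWithin (m := j)
      (by exact_mod_cast (by omega : j < m + 1)) (uniqueDiffOn_Icc hlr) t ht
    have h2 := h1.hasDerivWithinAt
    rwa [← iteratedDerivWithin_succ] at h2
  set F := fun (j : ℕ) (t : ℝ) => if t < α then βm * D (j + 1) (Icc a α) t
    else βp * D (j + 1) (Icc α b) t with hF
  have hFm : ∀ j ≤ m, ∀ t ∈ Icc a α, F j t = βm * D (j + 1) (Icc a α) t := by
    intro j hjm t ht
    rcases ht.2.lt_or_eq with h | h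
    · exact if_pos h
    · subst h
      rw [hF]
      simp only [lt_irrefl, if_false]
      exact (hj (j + 1) (by omega) (by omega)).symm
  have hFp : ∀ j, ∀ t ∈ Icc α b, F j t = βp * D (j + 1) (Icc α b) t := fun j t ht =>
    if_neg (not_lt.2 ht.1)
  refine ⟨F, ?_, ?_, ?_⟩
  · intro j hjm t ht
    rw [← Icc_union_Icc_eq_Icc haα.le hαb.le]
    refine HasDerivWithinAt.union ?_ ?_
    · by_cases h : t ∈ Icc a α
      · rw [hFm (j + 1) (by omega) t h]
        exact ((hder haα hum (j + 1) (by omega) t h).const_mul βm).congr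
          (fun y hy => hFm j (by omega) y hy) (hFm j (by omega) t h)
      · exact HasFDerivWithinAt.of_notMem_closure (by rwa [isClosed_Icc.closure_eq])
    · by_cases h : t ∈ Icc α b
      · rw [hFp (j + 1) t h]
        exact ((hder hαb hup (j + 1) (by omega) t h).const_mul βp).congr
          (fun y hy => hFp j y hy) (hFp j t h)
      · exact HasFDerivWithinAt.of_notMem_closure (by rwa [isClosed_Icc.closure_eq])
  · intro j hjm t ht
    have hw := wnorm_nonneg (a := a) (b := b) (α := α) (m + 1) u
    rcases le_total t α with h | h
    · rw [hFm j hjm t ⟨ht.1, h⟩, abs_mul, abs_of_pos hβm]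
      exact mul_le_mul (le_max_left _ _) ((iteratedDerivWithin_abs_le haα hum (by omega)
        ⟨ht.1, h⟩).trans (le_max_left _ _)) (abs_nonneg _) (hβm.le.trans (le_max_left _ _))
    · rw [hFp j t ⟨h, ht.2⟩, abs_mul, abs_of_pos hβp]
      exact mul_le_mul (le_max_right _ _) ((iteratedDerivWithin_abs_le hαb hup (by omega)
        ⟨h, ht.2⟩).trans (le_max_right _ _)) (abs_nonneg _) (hβm.le.trans (le_max_left _ _))
  · intro t ht htα
    have h0 : ∀ s, D 0 s = u := fun s => by ext y; simp [hD]
    rcases lt_or_gt_of_ne htα with h | h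
    · have h1 := hder haα hum 0 (Nat.zero_le _) t ⟨ht.1.le, h.le⟩
      rw [h0] at h1
      rw [hFm 0 (Nat.zero_le _) t ⟨ht.1.le, h.le⟩, betaPW_of_lt h, mul_comm,
        inv_mul_cancel_left₀ hβm.ne']
      exact h1.hasDerivAt (Icc_mem_nhds ht.1 h)
    · have h1 := hder hαb hup 0 (Nat.zero_le _) t ⟨h.le, ht.2.le⟩
      rw [h0] at h1
      rw [hFp 0 t ⟨h.le, ht.2.le⟩, betaPW_of_le h.le, mul_comm,
        inv_mul_cancel_left₀ hβp.ne']
      exact h1.hasDerivAt (Icc_mem_nhds h ht.2)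

lemma iteratedDeriv_two_of_flux {u F₀ : ℝ → ℝ} {F₁ t : ℝ}
    (hu : ∀ t ∈ Ioo a b, t ≠ α → HasDerivAt u (F₀ t * (betaPW βm βp α t)⁻¹) t)
    (ht : t ∈ Ioo a b) (htα : t ≠ α) (hF : HasDerivAt F₀ F₁ t) :
    iteratedDeriv 2 u t = F₁ * (betaPW βm βp α t)⁻¹ := by
  rw [iteratedDeriv_succ, iteratedDeriv_one]
  refine ((hF.mul_const _).congr_of_eventuallyEq ?_).deriv
  filter_upwards [Ioo_mem_nhds ht.1 ht.2, betaPW_eventuallyEq (βm := βm) (βp := βp) htα,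
    isOpen_ne.mem_nhds htα] with s hs hb hsα
  rw [(hu s hs hsα).deriv, hb]

end Interface

section Scheme

variable {a b α βm βp : ℝ}

lemma exists_mem_open_element {N : ℕ} {x : ℕ → ℝ} (hN : 1 ≤ N) {t : ℝ}
    (ht : t ∈ Ioo (x 0) (x N)) (hx : t ∉ range x) : ∃ i < N, t ∈ Ioo (x i) (x (i + 1)) := by
  obtain ⟨i, hi, hti⟩ := exists_mem_element hN ⟨ht.1.le, ht.2.le⟩
  exact ⟨i, hi, lt_of_le_of_ne hti.1 fun h => hx ⟨i, h⟩,
    lt_of_le_of_ne hti.2 fun h => hx ⟨i + 1, h.symm⟩⟩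

lemma intervalIntegrable_betaPW_inv (hβm : 0 < βm) (hβp : 0 < βp) (s t : ℝ) :
    IntervalIntegrable (fun y => (betaPW βm βp α y)⁻¹) volume s t := by
  have hmin : 0 < min βm βp := lt_min hβm hβp
  refine (intervalIntegrable_const (c := (min βm βp)⁻¹)).mono_fun
    measurable_betaPW.inv.aestronglyMeasurable ?_
  refine Filter.Eventually.of_forall fun t => ?_
  change ‖(betaPW βm βp α t)⁻¹‖ ≤ ‖(min βm βp)⁻¹‖
  rw [Real.norm_of_nonneg (inv_nonneg.2 (betaPW_pos hβm hβp t).le),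
    Real.norm_of_nonneg (inv_nonneg.2 hmin.le)]
  exact inv_anti₀ hmin (le_betaPW t)

lemma integral_deriv_of_flux_polynomials {N : ℕ} {x : ℕ → ℝ} {v : ℝ → ℝ}
    {P : ℕ → Polynomial ℝ} (hβm : 0 < βm) (hβp : 0 < βp) (hN : 1 ≤ N)
    (hx : ∀ i < N, x i < x (i + 1)) (hv : ContinuousOn v (Icc (x 0) (x N)))
    (hP : ∀ i < N, ∀ t ∈ Ioo (x i) (x (i + 1)), t ≠ α →
      HasDerivAt v ((P i).eval t * (betaPW βm βp α t)⁻¹) t) {s t : ℝ}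
    (hs : s ∈ Icc (x 0) (x N)) (ht : t ∈ Icc (x 0) (x N)) :
    IntervalIntegrable (deriv v) volume s t ∧ ∫ y in s..t, deriv v y = v t - v s ∧
      ∫ y in s..t, piecewisePoly N x P y * (betaPW βm βp α y)⁻¹ = v t - v s := by
  refine integral_deriv_off_countable (S := range x ∪ {α})
    ((countable_range x).union (countable_singleton α)) hv ?_
    (fun s hs t ht => piecewisePoly_mul_intervalIntegrable hx
      (intervalIntegrable_betaPW_inv hβm hβp) P hs ht) hs ht
  rintro t ⟨ht, hS⟩
  simp only [mem_union, mem_singleton_iff, not_or] at hS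
  obtain ⟨i, hi, hti⟩ := exists_mem_open_element hN ht hS.1
  rw [piecewisePoly_eq hx P hi ⟨hti.1, hti.2.le⟩]
  exact hP i hi t hti hS.2

lemma integral_deriv_of_flux {u F₀ : ℝ → ℝ} (hβm : 0 < βm) (hβp : 0 < βp)
    (hu : ContinuousOn u (Icc a b)) (hF : ContinuousOn F₀ (Icc a b))
    (hd : ∀ t ∈ Ioo a b, t ≠ α → HasDerivAt u (F₀ t * (betaPW βm βp α t)⁻¹) t) {s t : ℝ}
    (hs : s ∈ Icc a b) (ht : t ∈ Icc a b) :
    IntervalIntegrable (deriv u) volume s t ∧ ∫ y in s..t, deriv u y = u t - u s ∧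
      ∫ y in s..t, F₀ y * (betaPW βm βp α y)⁻¹ = u t - u s :=
  integral_deriv_off_countable (countable_singleton α) hu (fun t ht => hd t ht.1 ht.2)
    (fun s hs t ht => (intervalIntegrable_betaPW_inv hβm hβp s t).continuousOn_mul
      (hF.mono (uIcc_subset_Icc hs ht))) hs ht

/-- Balance of the exact flux on a control volume. -/
lemma integral_source_eq {u f : ℝ → ℝ} {F : ℕ → ℝ → ℝ} {γ c : ℝ} (hβm : 0 < βm) (hβp : 0 < βp)
    (hu : ContinuousOn u (Icc a b))
    (hF : ∀ j < 2, ∀ t ∈ Icc a b, HasDerivWithinAt (F j) (F (j + 1) t) (Icc a b) t)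
    (hd : ∀ t ∈ Ioo a b, t ≠ α → HasDerivAt u (F 0 t * (betaPW βm βp α t)⁻¹) t)
    (heq : ∀ t, t ∈ Ioo a α ∪ Ioo α b →
      -(betaPW βm βp α t * iteratedDeriv 2 u t) + γ * deriv u t + c * u t = f t) {s t : ℝ}
    (hs : s ∈ Ioo a b) (ht : t ∈ Ioo a b) :
    ∫ y in s..t, f y = F 0 s - F 0 t + γ * (u t - u s) + c * ∫ y in s..t, u y := by
  have hs' := Ioo_subset_Icc_self hs
  have ht' := Ioo_subset_Icc_self ht
  have hFc : ∀ j < 2, ContinuousOn (F j) (Icc a b) := fun j hj t ht =>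
    (hF j hj t ht).continuousWithinAt
  obtain ⟨i1, e1, -⟩ := integral_deriv_of_flux hβm hβp hu (hFc 0 (by omega)) hd hs' ht'
  have hFd : ∀ y ∈ Ioo a b, HasDerivAt (F 0) (F 1 y) y := fun y hy =>
    (hF 0 (by omega) y (Ioo_subset_Icc_self hy)).hasDerivAt (Icc_mem_nhds hy.1 hy.2)
  have hcont : ContinuousOn (F 1) (Icc a b) := hFc 1 (by omega)
  have i2 : IntervalIntegrable (F 1) volume s t :=
    (hcont.mono (uIcc_subset_Icc hs' ht')).intervalIntegrable
  have i2n : IntervalIntegrable (fun y => -F 1 y) volume s t := i2.neg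
  have i3 : IntervalIntegrable u volume s t :=
    (hu.mono (uIcc_subset_Icc hs' ht')).intervalIntegrable
  have hsub : uIcc s t ⊆ Ioo a b := ordConnected_Ioo.uIcc_subset hs ht
  have e2 : ∫ y in s..t, F 1 y = F 0 t - F 0 s :=
    integral_eq_sub_of_hasDerivAt (fun y hy => hFd y (hsub hy)) i2
  have e3 : ∫ y in s..t, f y = ∫ y in s..t, (-F 1 y + γ * deriv u y + c * u y) := by
    refine integral_congr_ae ?_
    have : ∀ᵐ y : ℝ, y ∉ ({α} : Set ℝ) :=
      measure_eq_zero_iff_ae_notMem.1 ((countable_singleton α).measure_zero _)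
    filter_upwards [this] with y hy hy'
    have hyα : y ≠ α := hy
    have hyab := hsub (uIoc_subset_uIcc hy')
    rw [← heq y (by
      rcases lt_or_gt_of_ne hyα with h | h
      · exact Or.inl ⟨hyab.1, h⟩
      · exact Or.inr ⟨h, hyab.2⟩), iteratedDeriv_two_of_flux hd hyab hyα (hFd y hyab),
      mul_comm (F 1 y), mul_inv_cancel_left₀ (betaPW_pos hβm hβp y).ne']
  rw [e3, intervalIntegral.integral_add (i2n.add (i1.const_mul γ)) (i3.const_mul c),
    intervalIntegral.integral_add i2n (i1.const_mul γ), intervalIntegral.integral_neg,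
    intervalIntegral.integral_const_mul, intervalIntegral.integral_const_mul, e1, e2]
  ring

lemma eq_of_consecutive {p N : ℕ} {g : ℕ → ℕ → ℝ} {Z : ℝ → ℝ} (hp : 1 ≤ p)
    (hnext : ∀ i, 1 ≤ i → i < N → g i (p + 1) = g (i + 1) 1)
    (hstep : ∀ i, 1 ≤ i → i ≤ N → ∀ j, 1 ≤ j → j ≤ (if i < N then p else p - 1) →
      Z (g i j) = Z (g i (j + 1))) {i j : ℕ} (hi : i < N) (hj : j ∈ Finset.Icc 1 p) :
    Z (g (i + 1) j) = Z (g 1 1) := by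
  have hin : ∀ i, 1 ≤ i → i ≤ N → ∀ j, 1 ≤ j → j ≤ p → Z (g i j) = Z (g i 1) := by
    intro i hi hiN j hj1
    induction j, hj1 using Nat.le_induction with
    | base => exact fun _ => rfl
    | succ j hj1 ih =>
      intro hjp
      rw [← hstep i hi hiN j hj1 (by split_ifs <;> omega), ih (by omega)]
  rw [Finset.mem_Icc] at hj
  rw [hin (i + 1) (by omega) (by omega) j hj.1 hj.2]
  induction i with
  | zero => rfl
  | succ n ih =>
    rw [← hnext (n + 1) (by omega) hi, ← hstep (n + 1) (by omega) (by omega) p hp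
      (by rw [if_pos hi]), hin (n + 1) (by omega) (by omega) p hp le_rfl]
    exact ih (by omega)

/-- The residual of the scheme is the same at all Gauss points. -/
lemma flux_error_eq {p N : ℕ} {x : ℕ → ℝ} {g : ℕ → ℕ → ℝ} {u uT f : ℝ → ℝ} {F : ℕ → ℝ → ℝ}
    {P : ℕ → Polynomial ℝ} {γ c : ℝ} (hβm : 0 < βm) (hβp : 0 < βp) (hp : 1 ≤ p) (hN : 1 ≤ N)
    (hx : ∀ i < N, x i < x (i + 1)) (hx0 : x 0 = a) (hxN : x N = b)
    (hg : ∀ i ∈ Finset.Icc 1 N, ∀ j ∈ Finset.Icc 1 p,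
      x (i - 1) < g i j ∧ g i j < x i ∧ g i j ≠ α)
    (hnext : ∀ i, 1 ≤ i → i < N → g i (p + 1) = g (i + 1) 1)
    (hu : ContinuousOn u (Icc a b)) (huT : ContinuousOn uT (Icc a b))
    (hF : ∀ j < 2, ∀ t ∈ Icc a b, HasDerivWithinAt (F j) (F (j + 1) t) (Icc a b) t)
    (hd : ∀ t ∈ Ioo a b, t ≠ α → HasDerivAt u (F 0 t * (betaPW βm βp α t)⁻¹) t)
    (hP : ∀ i < N, ∀ t ∈ Ioo (x i) (x (i + 1)), t ≠ α →
      HasDerivAt uT ((P i).eval t * (betaPW βm βp α t)⁻¹) t)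
    (heq : ∀ t, t ∈ Ioo a α ∪ Ioo α b →
      -(betaPW βm βp α t * iteratedDeriv 2 u t) + γ * deriv u t + c * u t = f t)
    (hscheme : ∀ i, 1 ≤ i → i ≤ N → ∀ j, 1 ≤ j → j ≤ (if i < N then p else p - 1) →
      betaPW βm βp α (g i j) * deriv uT (g i j)
        - betaPW βm βp α (g i (j + 1)) * deriv uT (g i (j + 1))
        + (∫ t in (g i j)..(g i (j + 1)), (γ * deriv uT t + c * uT t))
        = ∫ t in (g i j)..(g i (j + 1)), f t) :
    ∃ κ' : ℝ, ∀ i < N, ∀ j ∈ Finset.Icc 1 p,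
      (P i).eval (g (i + 1) j) - F 0 (g (i + 1) j) = κ' +
        γ * (uT (g (i + 1) j) - u (g (i + 1) j)) + c * ∫ y in a..(g (i + 1) j), (uT y - u y) := by
  set Z := fun s => betaPW βm βp α s * deriv uT s - F 0 s - γ * (uT s - u s) -
    c * ∫ y in a..s, (uT y - u y) with hZ
  have hgI : ∀ i, 1 ≤ i → i ≤ N → ∀ j, 1 ≤ j → j ≤ p → g i j ∈ Ioo a b := by
    intro i hi hiN j hj hjp
    obtain ⟨h1, h2, -⟩ := hg i (Finset.mem_Icc.2 ⟨hi, hiN⟩) j (Finset.mem_Icc.2 ⟨hj, hjp⟩)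
    have h3 := mesh_mono hx (Nat.zero_le (i - 1)) (by omega)
    have h4 := mesh_mono hx hiN le_rfl
    rw [hx0] at h3
    rw [hxN] at h4
    exact ⟨h3.trans_lt h1, h2.trans_le h4⟩
  have hab : a ≤ b := by
    rw [← hx0, ← hxN]
    exact mesh_mono hx (Nat.zero_le _) le_rfl
  have hint : ∀ {v : ℝ → ℝ} {s t : ℝ}, ContinuousOn v (Icc a b) → s ∈ Icc a b → t ∈ Icc a b →
      IntervalIntegrable v volume s t := fun hv hs ht =>
    (hv.mono (uIcc_subset_Icc hs ht)).intervalIntegrable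
  have hstep : ∀ i, 1 ≤ i → i ≤ N → ∀ j, 1 ≤ j → j ≤ (if i < N then p else p - 1) →
      Z (g i j) = Z (g i (j + 1)) := by
    intro i hi hiN j hj hjp
    have hs : g i j ∈ Ioo a b := hgI i hi hiN j hj (by split_ifs at hjp <;> omega)
    have ht : g i (j + 1) ∈ Ioo a b := by
      by_cases hjp' : j = p
      · subst hjp'
        have hiN' : i < N := by
          by_contra h
          rw [if_neg h] at hjp
          omega
        rw [hnext i hi hiN']
        exact hgI (i + 1) (by omega) (by omega) 1 le_rfl hp
      · exact hgI i hi hiN (j + 1) (by omega) (by split_ifs at hjp <;> omega)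
    have hs' := Ioo_subset_Icc_self hs
    have ht' := Ioo_subset_Icc_self ht
    have e1 := hscheme i hi hiN j hj hjp
    rw [integral_source_eq hβm hβp hu hF hd heq hs ht] at e1
    obtain ⟨i2, e2, -⟩ := integral_deriv_of_flux_polynomials hβm hβp hN hx
      (by rwa [hx0, hxN]) hP (s := g i j) (t := g i (j + 1)) (by rwa [hx0, hxN])
      (by rwa [hx0, hxN])
    rw [intervalIntegral.integral_add (i2.const_mul γ) ((hint huT hs' ht').const_mul c),
      intervalIntegral.integral_const_mul, intervalIntegral.integral_const_mul, e2] at e1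
    have ha : a ∈ Icc a b := ⟨le_rfl, hab⟩
    have hE : ContinuousOn (fun y => uT y - u y) (Icc a b) := huT.sub hu
    have e3 : ∫ y in a..(g i (j + 1)), (uT y - u y) = (∫ y in a..(g i j), (uT y - u y)) +
        ((∫ y in (g i j)..(g i (j + 1)), uT y) - ∫ y in (g i j)..(g i (j + 1)), u y) := by
      rw [← intervalIntegral.integral_sub (hint huT hs' ht') (hint hu hs' ht'),
        integral_add_adjacent_intervals (hint hE ha hs') (hint hE hs' ht')]
    simp only [hZ]
    rw [e3]
    linarith
  refine ⟨Z (g 1 1), fun i hi j hj => ?_⟩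
  rw [← eq_of_consecutive hp hnext hstep hi hj]
  obtain ⟨h1, h2, h3⟩ := hg (i + 1) (Finset.mem_Icc.2 ⟨by omega, by omega⟩) j hj
  rw [Nat.add_sub_cancel] at h1
  simp only [hZ]
  rw [(hP i hi _ ⟨h1, h2⟩ h3).deriv, mul_comm ((P i).eval _),
    mul_inv_cancel_left₀ (betaPW_pos hβm hβp _).ne']
  ring

lemma projection_orthogonal {p N k : ℕ} {x : ℕ → ℝ} {u v F₀ : ℝ → ℝ} {Q : ℕ → Polynomial ℝ}
    (hβm : 0 < βm) (hβp : 0 < βp) (hp : 1 ≤ p)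
    (hx : ∀ i < N, x i < x (i + 1)) (hk : 1 ≤ k) (hkN : k ≤ N)
    (hα : x (k - 1) < α) (hα' : α < x k) (hF : ContinuousOn F₀ (Icc (x 0) (x N)))
    (hd : ∀ t ∈ Ioo (x 0) (x N), t ≠ α → HasDerivAt u (F₀ t * (betaPW βm βp α t)⁻¹) t)
    (hQ : ∀ i < N, ∀ t ∈ Ioo (x i) (x (i + 1)), t ≠ α →
      HasDerivAt v ((Q i).eval t * (betaPW βm βp α t)⁻¹) t)
    (hel : ∀ i, 1 ≤ i → i ≤ N → i ≠ k → ∀ q : Polynomial ℝ, q.natDegree ≤ p →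
      ∫ t in (x (i - 1))..(x i),
        betaPW βm βp α t * (deriv u t - deriv v t) * (Polynomial.derivative q).eval t = 0)
    (hint : ∀ qm qp : Polynomial ℝ, qm.natDegree ≤ p → qp.natDegree ≤ p →
      qm.eval α = qp.eval α →
      (∀ j, 1 ≤ j → j ≤ p →
        βm * ((⇑Polynomial.derivative)^[j] qm).eval α
          = βp * ((⇑Polynomial.derivative)^[j] qp).eval α) →
      (∫ t in (x (k - 1))..α,
          betaPW βm βp α t * (deriv u t - deriv v t) * (Polynomial.derivative qm).eval t)
        + (∫ t in α..(x k),
            betaPW βm βp α t * (deriv u t - deriv v t) * (Polynomial.derivative qp).eval t)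
        = 0) :
    ∀ i < N, ∀ R : Polynomial ℝ, R.natDegree ≤ p - 1 →
      ∫ t in (x i)..(x (i + 1)), (F₀ t - (Q i).eval t) * R.eval t * (betaPW βm βp α t)⁻¹ = 0 := by
  intro i hi R hR
  have hflux : ∀ t ∈ Ioo (x i) (x (i + 1)), t ≠ α →
      betaPW βm βp α t * (deriv u t - deriv v t) = F₀ t - (Q i).eval t := by
    intro t ht htα
    have h1 := mesh_mono hx (Nat.zero_le i) hi.le
    have h2 := mesh_mono hx (Nat.succ_le_of_lt hi) le_rfl
    rw [(hd t ⟨h1.trans_lt ht.1, ht.2.trans_le h2⟩ htα).deriv, (hQ i hi t ht htα).deriv,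
      ← sub_mul, mul_comm (F₀ t - _), mul_inv_cancel_left₀ (betaPW_pos hβm hβp t).ne']
  obtain ⟨q, hq, hqd⟩ := exists_polynomial_antiderivative R
  have hconst : ∀ {l r β : ℝ}, l ≤ r → Ioo l r ⊆ Ioo (x i) (x (i + 1)) → α ∉ Ioo l r →
      (∀ t ∈ Ioo l r, betaPW βm βp α t = β) →
      ∫ t in l..r, (F₀ t - (Q i).eval t) * R.eval t * (betaPW βm βp α t)⁻¹ =
      ∫ t in l..r, betaPW βm βp α t * (deriv u t - deriv v t) *
        (Polynomial.derivative (Polynomial.C β⁻¹ * (q - Polynomial.C (q.eval α)))).eval t := by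
    intro l r β hlr hsub hαn hβ
    refine integral_congr_uIoo fun t ht => ?_
    rw [uIoo_of_le hlr] at ht
    rw [hflux t (hsub ht) (fun h => hαn (h ▸ ht)), hβ t ht]
    simp only [Polynomial.derivative_mul, Polynomial.derivative_C, Polynomial.derivative_sub,
      sub_zero, zero_mul, zero_add, hq, Polynomial.eval_mul, Polynomial.eval_C]
    ring
  have hdeg : ∀ β : ℝ, (Polynomial.C β * (q - Polynomial.C (q.eval α))).natDegree ≤ p := by
    intro β
    refine (Polynomial.natDegree_C_mul_le _ _).trans ?_
    rw [Polynomial.natDegree_sub_C]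
    omega
  by_cases hik : i + 1 = k
  · subst hik
    rw [Nat.add_sub_cancel] at hα hint
    have hiter : ∀ j, 1 ≤ j → ∀ β : ℝ, β ≠ 0 → β * ((⇑Polynomial.derivative)^[j]
        (Polynomial.C β⁻¹ * (q - Polynomial.C (q.eval α)))).eval α =
        ((⇑Polynomial.derivative)^[j] (q - Polynomial.C (q.eval α))).eval α := by
      intro j _ β hβ
      rw [Polynomial.iterate_derivative_C_mul, Polynomial.eval_mul, Polynomial.eval_C,
        mul_inv_cancel_left₀ hβ]
    have h := hint _ _ (hdeg βm⁻¹) (hdeg βp⁻¹) (by simp)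
      (fun j hj _ => by rw [hiter j hj βm hβm.ne', hiter j hj βp hβp.ne'])
    have hcont : ContinuousOn (fun t => (F₀ t - (Q i).eval t) * R.eval t)
        (Icc (x i) (x (i + 1))) :=
      ((hF.mono (mesh_subset hx hi)).sub (Q i).continuous.continuousOn).mul
        R.continuous.continuousOn
    have hii : ∀ {s t : ℝ}, s ∈ Icc (x i) (x (i + 1)) → t ∈ Icc (x i) (x (i + 1)) →
        IntervalIntegrable (fun t => (F₀ t - (Q i).eval t) * R.eval t * (betaPW βm βp α t)⁻¹)
          volume s t := fun hs ht =>
      (intervalIntegrable_betaPW_inv hβm hβp _ _).continuousOn_mul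
        (hcont.mono (uIcc_subset_Icc hs ht))
    have mα : α ∈ Icc (x i) (x (i + 1)) := ⟨hα.le, hα'.le⟩
    rw [← integral_add_adjacent_intervals (hii ⟨le_rfl, (hx i hi).le⟩ mα)
      (hii mα ⟨(hx i hi).le, le_rfl⟩),
      hconst hα.le (Ioo_subset_Ioo le_rfl hα'.le) (by simp) (fun t ht => betaPW_of_lt ht.2),
      hconst hα'.le (Ioo_subset_Ioo hα.le le_rfl) (by simp) (fun t ht => betaPW_of_le ht.1.le)]
    exact h
  · have h : ∀ β, (∀ t ∈ Ioo (x i) (x (i + 1)), betaPW βm βp α t = β) →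
        α ∉ Ioo (x i) (x (i + 1)) → _ = _ := fun β h1 h2 =>
      hconst (β := β) (hx i hi).le Subset.rfl h2 h1
    have h0 := hel (i + 1) (by omega) (by omega) hik
    rw [Nat.add_sub_cancel] at h0
    rcases lt_or_ge (i + 1) k with hlt | hge
    · have h1 : x (i + 1) ≤ x (k - 1) := mesh_mono hx (by omega) (by omega)
      rw [h βm (fun t ht => betaPW_of_lt (by linarith [ht.2])) (fun h => by linarith [h.2])]
      exact h0 _ (hdeg _)
    · have h1 : x k ≤ x i := mesh_mono hx (by omega) (by omega)
      rw [h βp (fun t ht => betaPW_of_le (by linarith [ht.1])) (fun h => by linarith [h.1])]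
      exact h0 _ (hdeg _)

end Scheme

section Superclose

variable {a b α βm βp : ℝ}

lemma isGaussMesh_betaPW_inv {p N : ℕ} {hm κ : ℝ} {x : ℕ → ℝ} {g A : ℕ → ℕ → ℝ} (hp : 2 ≤ p)
    (hβm : 0 < βm) (hβp : 0 < βp) (hκ : 0 < κ) (hN : 1 ≤ N) (hx : ∀ i < N, x i < x (i + 1))
    (hg : ∀ i ∈ Finset.Icc 1 N, ∀ j ∈ Finset.Icc 1 p,
      x (i - 1) < g i j ∧ g i j < x i ∧ g i j ≠ α)
    (hmono : ∀ i ∈ Finset.Icc 1 N, ∀ j, 1 ≤ j → j < p → g i j < g i (j + 1))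
    (hA : ∀ i ∈ Finset.Icc 1 N, ∀ j ∈ Finset.Icc 1 p, 0 < A i j)
    (hquad : ∀ i ∈ Finset.Icc 1 N, ∀ F : Polynomial ℝ, F.natDegree ≤ 2 * p - 1 →
      ∑ j ∈ Finset.Icc 1 p, A i j * F.eval (g i j)
        = ∫ t in (x (i - 1))..(x i), F.eval t / betaPW βm βp α t)
    (hAκ : ∀ i ∈ Finset.Icc 1 N, ∀ j ∈ Finset.Icc 1 p, κ * (x i - x (i - 1)) ≤ A i j)
    (hstep : ∀ i ∈ Finset.Icc 1 N, x i - x (i - 1) ≤ hm) :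
    IsGaussMesh p N (fun t => (betaPW βm βp α t)⁻¹) (min βm βp)⁻¹ hm κ x
      (fun i => g (i + 1)) (fun i => A (i + 1)) := by
  have hmem : ∀ {i}, i < N → i + 1 ∈ Finset.Icc 1 N := fun hi =>
    Finset.mem_Icc.2 ⟨by omega, hi⟩
  have hlt : ∀ i ∈ Finset.Icc 1 N, ∀ j, 1 ≤ j → ∀ l, j < l → l ≤ p → g i j < g i l := by
    intro i hi j hj l hjl
    induction l, hjl using Nat.le_induction with
    | base => exact fun h => hmono i hi j hj h
    | succ l hl ih => exact fun h => (ih (by omega)).trans (hmono i hi l (by omega) (by omega))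
  refine ⟨hp, hN, hx, fun i hi => ?_, measurable_betaPW.inv,
    fun t => (inv_pos.2 (betaPW_pos hβm hβp t)).le,
    fun t => inv_anti₀ (lt_min hβm hβp) (le_betaPW t), fun i hi j hj => ?_, fun i hi => ?_,
    fun i hi => hA _ (hmem hi), hκ, fun i hi j hj => ?_, fun i hi F hF => ?_⟩
  · simpa using hstep _ (hmem hi)
  · obtain ⟨h1, h2, -⟩ := hg _ (hmem hi) j hj
    exact ⟨h1.le, h2.le⟩
  · intro j hj l hl hjl
    simp only [Finset.coe_Icc, mem_Icc] at hj hl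
    rcases lt_trichotomy j l with h | h | h
    · exact absurd hjl (hlt _ (hmem hi) j hj.1 l h hl.2).ne
    · exact h
    · exact absurd hjl (hlt _ (hmem hi) l hl.1 j h hj.2).ne'
  · simpa using hAκ _ (hmem hi) j hj
  · simpa only [Nat.add_sub_cancel, div_eq_mul_inv] using hquad _ (hmem hi) F hF

lemma le_integral_betaPW_inv (hβm : 0 < βm) (hβp : 0 < βp) (hab : a ≤ b) :
    (max βm βp)⁻¹ * (b - a) ≤ ∫ t in a..b, (betaPW βm βp α t)⁻¹ := by
  have h := intervalIntegral.integral_mono_on hab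
    (intervalIntegrable_const (c := (max βm βp)⁻¹))
    (intervalIntegrable_betaPW_inv hβm hβp a b)
    (fun t _ => inv_anti₀ (betaPW_pos hβm hβp t) (betaPW_le (α := α) t))
  rwa [intervalIntegral.integral_const, smul_eq_mul, mul_comm] at h

lemma betaPW_eq_const_of_ne {N k i : ℕ} {x : ℕ → ℝ} (hx : ∀ i < N, x i < x (i + 1))
    (hk : 1 ≤ k) (hkN : k ≤ N) (hα : x (k - 1) < α) (hα' : α < x k) (hi : i < N)
    (hik : i ≠ k - 1) : ∃ v, ∀ t ∈ Icc (x i) (x (i + 1)), betaPW βm βp α t = v := by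
  rcases lt_or_ge i (k - 1) with h | h
  · have h1 : x (i + 1) ≤ x (k - 1) := mesh_mono hx h (by omega)
    exact ⟨βm, fun t ht => betaPW_of_lt (by linarith [ht.2])⟩
  · have h1 : x k ≤ x i := mesh_mono hx (by omega) hi.le
    exact ⟨βp, fun t ht => betaPW_of_le (by linarith [ht.1])⟩

end Superclose

end Auxiliary

/-- for `p ≥ 2`, `c > 0`, `A_{i,j} ≥ κ hᵢ` and a `σ`-shape-regular partition,
if `u ∈ W̃_β^{2p+1,∞}` solves the interface problem and `u_T` is an IFVM solution with the
same data, then for `h ≤ h₀` the IFVM solution is superclose to the Gauss–Lobatto projection: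
`sup_{[a,b]} |u_T − I_h u| ≤ C h^{p+2} ‖u‖_{2p+1,∞}`. -/
theorem stmt_15 (p : ℕ) (hp : 2 ≤ p) (βm βp γ c κ σ d : ℝ)
    (hβm : 0 < βm) (hβp : 0 < βp) (hc : 0 < c) (hκ : 0 < κ) (hσ : 0 < σ) (hd : 0 < d) :
    ∃ h₀ C : ℝ, 0 < h₀ ∧ 0 < C ∧
    (∀ (N k : ℕ) (a b α hm : ℝ) (x : ℕ → ℝ) (g A : ℕ → ℕ → ℝ),
    b - a = d →
    1 ≤ N →
    1 ≤ k →
    k ≤ N →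
    a < b →
    x 0 = a →
    x N = b →
    (∀ i, i < N → x i < x (i + 1)) →
    x (k - 1) < α →
    α < x k →
    (∀ i ∈ Finset.Icc 1 N, ∀ j ∈ Finset.Icc 1 p,
      x (i - 1) < g i j ∧ g i j < x i ∧ g i j ≠ α) →
    (∀ i ∈ Finset.Icc 1 N, ∀ j, 1 ≤ j → j < p → g i j < g i (j + 1)) →
    (∀ i, 1 ≤ i → i < N → g i (p + 1) = g (i + 1) 1) →
    (∀ i ∈ Finset.Icc 1 N, ∀ j ∈ Finset.Icc 1 p, 0 < A i j) →
    (∀ i ∈ Finset.Icc 1 N, ∀ F : Polynomial ℝ, F.natDegree ≤ 2 * p - 1 →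
      ∑ j ∈ Finset.Icc 1 p, A i j * F.eval (g i j)
        = ∫ t in (x (i - 1))..(x i), F.eval t / betaPW βm βp α t) →
    (∀ i ∈ Finset.Icc 1 N, ∀ j ∈ Finset.Icc 1 p, κ * (x i - x (i - 1)) ≤ A i j) →
    (∀ i ∈ Finset.Icc 1 N, ∀ i' ∈ Finset.Icc 1 N,
      x i - x (i - 1) ≤ σ * (x i' - x (i' - 1))) →
    (∀ i ∈ Finset.Icc 1 N, x i - x (i - 1) ≤ hm) →
    hm ≤ h₀ →
    ∀ (f u uT : ℝ → ℝ),
    ContinuousOn f (Set.Ioo a α ∪ Set.Ioo α b) →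
    (∃ Mf : ℝ, ∀ t ∈ Set.Icc a b, |f t| ≤ Mf) →
    MemW (2 * p + 1) a b α βm βp u →
    (∀ t, t ∈ Set.Ioo a α ∪ Set.Ioo α b →
      -(betaPW βm βp α t * iteratedDeriv 2 u t) + γ * deriv u t + c * u t = f t) →
    MemUT p N k a b α βm βp x uT →
    (∀ i, 1 ≤ i → i ≤ N → ∀ j, 1 ≤ j → j ≤ (if i < N then p else p - 1) →
      betaPW βm βp α (g i j) * deriv uT (g i j)
        - betaPW βm βp α (g i (j + 1)) * deriv uT (g i (j + 1))
        + (∫ t in (g i j)..(g i (j + 1)), (γ * deriv uT t + c * uT t))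
        = ∫ t in (g i j)..(g i (j + 1)), f t) →
    ∀ Ihu : ℝ → ℝ,
    ContinuousOn Ihu (Set.Icc a b) →
    (∀ i, 1 ≤ i → i ≤ N → i ≠ k → ∃ q : Polynomial ℝ, q.natDegree ≤ p ∧
      ∀ y ∈ Set.Icc (x (i - 1)) (x i), Ihu y = q.eval y) →
    (∃ qm qp : Polynomial ℝ, qm.natDegree ≤ p ∧ qp.natDegree ≤ p ∧
      (∀ y ∈ Set.Icc (x (k - 1)) α, Ihu y = qm.eval y) ∧
      (∀ y ∈ Set.Icc α (x k), Ihu y = qp.eval y) ∧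
      ∀ j, 1 ≤ j → j ≤ p →
        βm * ((⇑Polynomial.derivative)^[j] qm).eval α
          = βp * ((⇑Polynomial.derivative)^[j] qp).eval α) →
    (∀ i, 1 ≤ i → i ≤ N → Ihu (x (i - 1)) = u (x (i - 1)) ∧ Ihu (x i) = u (x i)) →
    (∀ i, 1 ≤ i → i ≤ N → i ≠ k → ∀ q : Polynomial ℝ, q.natDegree ≤ p →
      ∫ t in (x (i - 1))..(x i),
        betaPW βm βp α t * (deriv u t - deriv Ihu t) * (Polynomial.derivative q).eval t = 0) →
    (∀ qm qp : Polynomial ℝ, qm.natDegree ≤ p → qp.natDegree ≤ p →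
      qm.eval α = qp.eval α →
      (∀ j, 1 ≤ j → j ≤ p →
        βm * ((⇑Polynomial.derivative)^[j] qm).eval α
          = βp * ((⇑Polynomial.derivative)^[j] qp).eval α) →
      (∫ t in (x (k - 1))..α,
          betaPW βm βp α t * (deriv u t - deriv Ihu t) * (Polynomial.derivative qm).eval t)
        + (∫ t in α..(x k),
            betaPW βm βp α t * (deriv u t - deriv Ihu t) * (Polynomial.derivative qp).eval t)
        = 0) →
    ∀ t ∈ Set.Icc a b, |uT t - Ihu t| ≤ C * hm ^ (p + 2) * wnorm (2 * p + 1) a b α u) := by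
  have hmax : 0 < max βm βp := lt_max_of_lt_left hβm
  obtain ⟨h₀, C, hh₀, hC, hmain⟩ := exists_superclose_constants (p := p) (κ := κ) (γ := γ)
    (W := (min βm βp)⁻¹) (L₀ := (max βm βp)⁻¹ * d) (inv_pos.2 (lt_min hβm hβp)).le hc.le hd
    (by positivity)
  refine ⟨h₀, C * max βm βp + 1, hh₀, by positivity, ?_⟩
  intro N k a b α hm x g A hba hN hk hkN hab hx0 hxN hx hα hα' hg hmono hnext hA hquad hAκ _
    hstep hmh₀ f u uT _ _ hu heq huT hscheme Ihu hIc hIel hIint hInode hIorth hIorthk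
  have hp1 : 1 ≤ p := by omega
  have haα : a < α := by
    rw [← hx0]
    exact (mesh_mono hx (Nat.zero_le _) (by omega)).trans_lt hα
  have hαb : α < b := by
    rw [← hxN]
    exact hα'.trans_le (mesh_mono hx hkN le_rfl)
  have hmesh := isGaussMesh_betaPW_inv hp hβm hβp hκ hN hx hg hmono hA hquad hAκ hstep
  obtain ⟨F, hF, hFb, hud⟩ := MemW.exists_flux (m := 2 * p) hu hβm hβp haα hαb
  obtain ⟨huc, hua, hub, -⟩ := hu
  obtain ⟨huTc, huTa, huTb, huTel, huTint⟩ := huT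
  obtain ⟨P, hPd, hP⟩ := exists_flux_polynomials hβm hβp hp1 hx hk hkN hα hα' huTel huTint
  obtain ⟨Q, hQd, hQ⟩ := exists_flux_polynomials hβm hβp hp1 hx hk hkN hα hα' hIel hIint
  subst hx0 hxN
  have hFc : ContinuousOn (F 0) (Icc (x 0) (x N)) := fun t ht =>
    (hF 0 (by omega) t ht).continuousWithinAt
  obtain ⟨κ', hκ'⟩ := flux_error_eq hβm hβp hp1 hN hx rfl rfl hg hnext huc huTc
    (fun j hj => hF j (by omega)) hud hP heq hscheme
  have hIa : Ihu (x 0) = 0 := ((hInode 1 le_rfl hN).1).trans hua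
  have hIb : Ihu (x N) = 0 := ((hInode N hN le_rfl).2).trans hub
  have hM : 0 ≤ max βm βp * wnorm (2 * p + 1) (x 0) (x N) α u :=
    mul_nonneg hmax.le (wnorm_nonneg _ _)
  have m0 : x 0 ∈ Icc (x 0) (x N) := ⟨le_rfl, hab.le⟩
  have hpw : ∀ (R : ℕ → Polynomial ℝ), ∀ t ∈ Icc (x 0) (x N), IntervalIntegrable
      (fun y => piecewisePoly N x R y * (betaPW βm βp α y)⁻¹) MeasureTheory.volume (x 0) t := fun R t ht =>
    piecewisePoly_mul_intervalIntegrable hx (intervalIntegrable_betaPW_inv hβm hβp) R m0 ht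
  have hη : ∀ t ∈ Icc (x 0) (x N), IsGaussMesh.errorPrimitive N x
      (fun t => (betaPW βm βp α t)⁻¹) (F 0) Q t = u t - Ihu t := by
    intro t ht
    simp only [IsGaussMesh.errorPrimitive, sub_mul]
    rw [intervalIntegral.integral_sub ((intervalIntegrable_betaPW_inv hβm hβp _ _).continuousOn_mul
      (hFc.mono (uIcc_subset_Icc m0 ht))) (hpw Q t ht),
      (integral_deriv_of_flux hβm hβp huc hFc hud m0 ht).2.2,
      (integral_deriv_of_flux_polynomials hβm hβp hN hx hIc hQ m0 ht).2.2, hua, hIa]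
    ring
  have he : ∀ t ∈ Icc (x 0) (x N), uT t - Ihu t = ∫ y in (x 0)..t,
      (piecewisePoly N x P y - piecewisePoly N x Q y) * (betaPW βm βp α y)⁻¹ := by
    intro t ht
    simp only [sub_mul]
    rw [intervalIntegral.integral_sub (hpw P t ht) (hpw Q t ht),
      (integral_deriv_of_flux_polynomials hβm hβp hN hx huTc hP m0 ht).2.2,
      (integral_deriv_of_flux_polynomials hβm hβp hN hx hIc hQ m0 ht).2.2, huTa, hIa]
    ring
  have hnod : ∀ i < N, ∀ j ∈ Finset.Icc 1 p, (P i).eval (g (i + 1) j) - F 0 (g (i + 1) j) = κ' +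
      γ * (uT (g (i + 1) j) - Ihu (g (i + 1) j) - IsGaussMesh.errorPrimitive N x
        (fun t => (betaPW βm βp α t)⁻¹) (F 0) Q (g (i + 1) j)) +
      c * ∫ y in (x 0)..(g (i + 1) j), (uT y - Ihu y - IsGaussMesh.errorPrimitive N x
        (fun t => (betaPW βm βp α t)⁻¹) (F 0) Q y) := by
    intro i hi j hj
    have hgm : g (i + 1) j ∈ Icc (x 0) (x N) := mesh_subset hx hi (hmesh.mem i hi j hj)
    rw [hκ' i hi j hj, hη _ hgm, sub_sub_sub_cancel_right]
    congr 2
    refine intervalIntegral.integral_congr fun y hy => ?_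
    rw [hη y (uIcc_subset_Icc m0 hgm hy), sub_sub_sub_cancel_right]
  have hT : ∀ m ≤ p + 1, ∀ i < N, ∃ T : Polynomial ℝ, T.natDegree ≤ m ∧
      ∀ t ∈ Icc (x i) (x (i + 1)), |F 0 t - T.eval t| ≤
        max βm βp * wnorm (2 * p + 1) (x 0) (x N) α u * hm ^ (m + 1) := by
    intro m hmp i hi
    have hsub := mesh_subset hx hi
    exact exists_taylor_polynomial (hx i hi).le (hmesh.step i hi) hM m
      (fun j hj t ht => (hF j (by omega) t (hsub ht)).mono hsub)
      (fun t ht => hFb (m + 1) (by omega) t (hsub ht))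
  have hconst : ∀ i < N, i ≠ k - 1 → ∃ v, ∀ t ∈ Icc (x i) (x (i + 1)),
      (betaPW βm βp α t)⁻¹ = v := by
    intro i hi hik
    obtain ⟨v, hv⟩ := betaPW_eq_const_of_ne (βm := βm) (βp := βp) hx hk hkN hα hα' hi hik
    exact ⟨v⁻¹, fun t ht => by rw [hv t ht]⟩
  have horth := projection_orthogonal hβm hβp hp1 hx hk hkN hα hα' hFc hud hQ hIorth hIorthk
  intro t ht
  refine (hmain (e := fun t => uT t - Ihu t) hmesh hba (hba ▸ le_integral_betaPW_inv hβm hβp hab.le)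
    hmh₀ hFc hPd hQd horth hM hT hconst he (by simp only [huTb, hIb, sub_zero]) hnod t ht).trans ?_
  have hnn : 0 ≤ hm ^ (p + 2) * wnorm (2 * p + 1) (x 0) (x N) α u :=
    mul_nonneg (pow_nonneg hmesh.h_pos.le _) (wnorm_nonneg _ _)
  linarith
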